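/- The Stein group F_{2,3} does not embed in Thompson's group V: there is no injective group homomorphism from F_{2,3} into V. -/

import Mathlib

/-- Cantor space `{0,1}^ℕ`. -/
abbrev Cantor : Type := ℕ → Bool

/-- Concatenation of a finite binary word with an element of Cantor space. -/
def capp (w : List Bool) (κ : Cantor) : Cantor :=
  fun n => if h : n < w.length then w.get ⟨n, h⟩ else κ (n - w.length)

/-- Membership in Thompson's group `V`: a permutation of Cantor space is in `V` if it is
locally given by prefix replacements. -/
def InV (h : Equiv.Perm Cantor) : Prop :=
  ∀ κ : Cantor, ∃ w u : List Bool,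
    (∀ i : Fin w.length, κ i = w.get i) ∧
    ∀ κ' : Cantor, h (capp w κ') = capp u κ'


/-- `f` is an element of the Bieri–Strebel group `F([p,q];A,P)`, realized as a
permutation of `ℝ` supported on `[p,q]`: it is an orientation-preserving piecewise-linear
homeomorphism of `[p,q]` (extended by the identity), with finitely many breakpoints, all
breakpoints in `A` and all slopes in `P`. -/
def IsBS (p q : ℝ) (A P : Set ℝ) (f : Equiv.Perm ℝ) : Prop :=
  Monotone ⇑f ∧ (∀ x : ℝ, x ∉ Set.Icc p q → f x = x) ∧
  ∃ (n : ℕ) (t : ℕ → ℝ), t 0 = p ∧ t n = q ∧ (∀ i : ℕ, i < n → t i < t (i + 1)) ∧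
    (∀ i : ℕ, 0 < i → i < n → t i ∈ A) ∧
    (∀ i : ℕ, i < n → ∃ c ∈ P, ∀ x ∈ Set.Icc (t i) (t (i + 1)),
      f x = f (t i) + c * (x - t i))

/-- The ring `ℤ[1/6]` inside `ℝ`. -/
def zOneSixth : Set ℝ := {x : ℝ | ∃ (z : ℤ) (k : ℕ), x = (z : ℝ) / 6 ^ k}

/-- The multiplicative set `{2^m · 3^n : m, n ∈ ℤ}` inside `ℝ`. -/
def twoThreePowers : Set ℝ := {x : ℝ | ∃ m k : ℤ, x = 2 ^ m * 3 ^ k}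


open Set Filter Topology
open scoped commutatorElement

namespace SteinV

/-- Agreement of two points on the first `N` letters. -/
def Agr (N : ℕ) (y x : Cantor) : Prop := ∀ i, i < N → y i = x i

/-- `h` is a prefix replacement near `x`, replacing `N` letters by `M` letters. -/
def Loc (h : Cantor → Cantor) (x : Cantor) (N M : ℕ) : Prop :=
  ∀ y, Agr N y x → Agr M (h y) (h x) ∧ ∀ i, h y (M + i) = y (N + i)

lemma Agr.mono {N M : ℕ} {x y : Cantor} (h : Agr N y x) (hM : M ≤ N) : Agr M y x :=
  fun i hi => h i (lt_of_lt_of_le hi hM)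

lemma Agr.symm {N : ℕ} {x y : Cantor} (h : Agr N y x) : Agr N x y := fun i hi => (h i hi).symm

lemma Agr.trans {N : ℕ} {x y z : Cantor} (h : Agr N x y) (h' : Agr N y z) : Agr N x z :=
  fun i hi => (h i hi).trans (h' i hi)

lemma Agr.rfl' {N : ℕ} {x : Cantor} : Agr N x x := fun _ _ => rfl

lemma Agr.add {M r N : ℕ} {x y x' y' : Cantor} (h : Agr M y x)
    (h1 : ∀ i, y (M + i) = y' (N + i)) (h2 : ∀ i, x (M + i) = x' (N + i))
    (h3 : Agr (N + r) y' x') : Agr (M + r) y x := by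
  intro i hi
  by_cases hiM : i < M
  · exact h i hiM
  · obtain ⟨j, rfl⟩ := Nat.exists_eq_add_of_le (not_lt.mp hiM)
    rw [h1, h2]
    exact h3 _ (by omega)

lemma Loc.ext {h : Cantor → Cantor} {x : Cantor} {N M : ℕ} (H : Loc h x N M) (r : ℕ) :
    Loc h x (N + r) (M + r) := by
  intro y hy
  have h1 := H y (hy.mono (by omega))
  have h2 := H x Agr.rfl'
  refine ⟨Agr.add h1.1 h1.2 h2.2 hy, fun i => ?_⟩
  rw [add_assoc, add_assoc]; exact h1.2 _

lemma Loc.transfer {h : Cantor → Cantor} {x x' : Cantor} {N M : ℕ} (H : Loc h x N M)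
    (hx : Agr N x' x) : Loc h x' N M := by
  intro y hy
  have h1 := H y (hy.trans hx)
  have h2 := H x' hx
  exact ⟨h1.1.trans h2.1.symm, h1.2⟩

lemma Loc.comp {h g : Cantor → Cantor} {x : Cantor} {N M P : ℕ} (H : Loc h x N M)
    (H' : Loc g (h x) M P) : Loc (fun y => g (h y)) x N P := by
  intro y hy
  have h1 := H y hy
  have h2 := H' (h y) h1.1
  exact ⟨h2.1, fun i => (h2.2 i).trans (h1.2 i)⟩

lemma Loc.inv {h : Equiv.Perm Cantor} {x : Cantor} {N M : ℕ} (H : Loc h x N M) :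
    Loc (h⁻¹ : Equiv.Perm Cantor) (h x) M N := by
  intro z hz
  set y : Cantor := fun i => if i < N then x i else z (M + (i - N)) with hy
  have hyx : Agr N y x := fun i hi => by simp [hy, hi]
  have hyN : ∀ i, y (N + i) = z (M + i) := fun i => by simp [hy]
  have h1 := H y hyx
  have : h y = z := by
    funext i
    by_cases hiM : i < M
    · rw [h1.1 i hiM, hz i hiM]
    · obtain ⟨j, rfl⟩ := Nat.exists_eq_add_of_le (not_lt.mp hiM)
      rw [h1.2, hyN]
  have hz' : (h⁻¹ : Equiv.Perm Cantor) z = y := by rw [← this]; simp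
  have hx' : (h⁻¹ : Equiv.Perm Cantor) (h x) = x := by simp
  rw [hz', hx']
  exact ⟨hyx, hyN⟩

lemma agr_mem_nhds (N : ℕ) (x : Cantor) : {y | Agr N y x} ∈ 𝓝 x :=
  (PiNat.isOpen_cylinder (fun _ => Bool) x N).mem_nhds (fun _ _ => rfl)

lemma isOpen_agr (N : ℕ) (x : Cantor) : IsOpen {y | Agr N y x} :=
  PiNat.isOpen_cylinder (fun _ => Bool) x N

lemma nhds_agr {x : Cantor} {U : Set Cantor} (hU : U ∈ 𝓝 x) : ∃ N, ∀ y, Agr N y x → y ∈ U := by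
  obtain ⟨V, ⟨z, N, rfl⟩, hx, hV⟩ :=
    (PiNat.isTopologicalBasis_cylinders (fun _ => Bool)).mem_nhds_iff.mp hU
  exact ⟨N, fun y hy => hV (fun i hi => (hy i hi).trans (hx i hi))⟩

lemma loc_of_inV {h : Equiv.Perm Cantor} (H : InV h) (x : Cantor) : ∃ N M, Loc h x N M := by
  obtain ⟨w, u, hw, hu⟩ := H x
  refine ⟨w.length, u.length, ?_⟩
  have key : ∀ y, Agr w.length y x → h y = capp u (fun i => y (w.length + i)) := by
    intro y hy
    rw [← hu]
    congr 1
    funext i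
    unfold capp
    split_ifs with hi
    · rw [hy i hi]; exact hw ⟨i, hi⟩
    · congr 1; omega
  intro y hy
  rw [key y hy, key x Agr.rfl']
  refine ⟨fun i hi => by simp [capp, hi], fun i => by simp [capp]⟩

lemma Loc.continuousAt {h : Cantor → Cantor} {x : Cantor} {N M : ℕ} (H : Loc h x N M) :
    ContinuousAt h x := by
  intro U hU
  obtain ⟨K, hK⟩ := nhds_agr hU
  refine Filter.mem_map.mpr (mem_of_superset (agr_mem_nhds (N + K) x) fun y hy => hK _ ?_)
  exact ((H.ext K) y hy).1.mono (by omega)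

lemma unif {h : Cantor → Cantor} (H : ∀ x, ∃ N M, Loc h x N M) :
    ∃ D, ∀ x, ∃ M, Loc h x D M := by
  choose N M hNM using H
  obtain ⟨t, -, ht⟩ := (isCompact_univ (X := Cantor)).elim_nhds_subcover
    (fun x => {y | Agr (N x) y x}) (fun x _ => agr_mem_nhds _ _)
  refine ⟨t.sup N, fun x => ?_⟩
  have := ht (mem_univ x)
  simp only [mem_iUnion] at this
  obtain ⟨z, hz, hxz⟩ := this
  have h1 := ((hNM z).transfer hxz).ext (t.sup N - N z)
  have h2 : N z ≤ t.sup N := Finset.le_sup hz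
  rw [Nat.add_sub_cancel' h2] at h1
  exact ⟨_, h1⟩

/-- Trivial germ. -/
def Triv (h : Equiv.Perm Cantor) (x : Cantor) : Prop := ∀ᶠ y in 𝓝 x, h y = y

lemma Triv.self {h : Equiv.Perm Cantor} {x : Cantor} (H : Triv h x) : h x = x := H.self_of_nhds

lemma isOpen_triv (h : Equiv.Perm Cantor) : IsOpen {x | Triv h x} := by
  rw [isOpen_iff_mem_nhds]
  intro x hx
  exact Filter.Eventually.eventually_nhds hx

lemma Triv.mul {g h : Equiv.Perm Cantor} {x : Cantor} (Hg : Triv g x) (H : Triv h x) :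
    Triv (g * h) x := by
  filter_upwards [Hg, H] with y h1 h2
  rw [Equiv.Perm.mul_apply, h2, h1]

lemma Triv.inv {h : Equiv.Perm Cantor} {x : Cantor} (H : Triv h x) : Triv h⁻¹ x := by
  filter_upwards [H] with y h1
  rw [Equiv.Perm.inv_eq_iff_eq, h1]

lemma triv_one (x : Cantor) : Triv 1 x := Eventually.of_forall fun _ => rfl

lemma Triv.pow {h : Equiv.Perm Cantor} {x : Cantor} (H : Triv h x) (n : ℕ) : Triv (h ^ n) x := by
  induction n with
  | zero => exact triv_one x
  | succ n ih => rw [pow_succ]; exact ih.mul H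

lemma Triv.conj {g h : Equiv.Perm Cantor} {x : Cantor} (H : Triv h x)
    (hc : ContinuousAt (g⁻¹ : Equiv.Perm Cantor) (g x)) : Triv (g * h * g⁻¹) (g x) := by
  have hc' : Tendsto (g⁻¹ : Equiv.Perm Cantor) (𝓝 (g x)) (𝓝 x) := by
    have := hc.tendsto
    simpa using this
  filter_upwards [hc'.eventually H] with y hy
  rw [Equiv.Perm.mul_apply, Equiv.Perm.mul_apply, hy]; simp

/-- a point different from `x` agreeing on `N` letters -/
lemma exists_agr_ne (N : ℕ) (x : Cantor) : ∃ y, Agr N y x ∧ y ≠ x := by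
  refine ⟨fun i => if i = N then !(x i) else x i, fun i hi => ?_, fun h => ?_⟩
  · simp [hi.ne]
  · have := congrFun h N
    simp at this

lemma triv_of_loc {h : Equiv.Perm Cantor} {x : Cantor} {N : ℕ} (H : Loc h x N N)
    (hx : h x = x) : Triv h x := by
  refine mem_of_superset (agr_mem_nhds N x) fun y hy => ?_
  have h1 := H y hy
  funext i
  by_cases hi : i < N
  · rw [h1.1 i hi, hx, hy i hi]
  · obtain ⟨j, rfl⟩ := Nat.exists_eq_add_of_le (not_lt.mp hi)
    exact h1.2 j

lemma loc_eq_of_triv {h : Equiv.Perm Cantor} {x : Cantor} {N M : ℕ} (H : Loc h x N M)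
    (T : Triv h x) : N = M := by
  obtain ⟨K, hK⟩ := nhds_agr T
  -- flip letter `N + K + M`
  set y : Cantor := fun i => if i = N + (K + M) then !(x i) else x i with hy
  have hyN : Agr (K + N) y x := fun i hi => by
    have : i ≠ N + (K + M) := by omega
    simp [hy, this]
  have h1 := (H y (hyN.mono (by omega))).2 (K + M)
  have h2 := (H x Agr.rfl').2 (K + M)
  rw [hK y (hyN.mono (by omega))] at h1
  rw [T.self] at h2
  by_contra hne
  have h3 : y (M + (K + M)) = x (M + (K + M)) := by
    have : ¬ M = N := fun h => hne h.symm
    simp [hy, this]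
  rw [h3, h2] at h1
  simp [hy] at h1

lemma triv_closed {h : Equiv.Perm Cantor} (H : ∀ x, ∃ N M, Loc h x N M) :
    IsClosed {x | Triv h x} := by
  rw [← isOpen_compl_iff, isOpen_iff_mem_nhds]
  intro x hx
  obtain ⟨N, M, hNM⟩ := H x
  refine mem_of_superset (agr_mem_nhds N x) fun y hy hyT => hx ?_
  change Triv h y at hyT
  have hL := hNM.transfer hy
  have hE := loc_eq_of_triv hL hyT
  subst hE
  have := hL x hy.symm
  refine triv_of_loc hNM ?_
  funext i
  by_cases hi : i < N
  · rw [this.1 i hi, hyT.self, hy i hi]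
  · obtain ⟨j, rfl⟩ := Nat.exists_eq_add_of_le (not_lt.mp hi)
    exact this.2 j

lemma pump_fw {k : Equiv.Perm Cantor} {D : ℕ} {M : Cantor → ℕ} (hM : ∀ x, Loc k x D (M x))
    {y : Cantor} {s : ℕ → ℤ} (hs : ∀ n, s (n + 1) = s n + (M ((k ^ n) y) - D))
    {n : ℕ} (hn : ∀ j, n ≤ j → s n ≤ s j) (j : ℕ) :
    ∃ t : ℕ, (t : ℤ) = s (n + j) - s n ∧
      Loc (k ^ j : Equiv.Perm Cantor) ((k ^ n) y) D (D + t) := by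
  induction j with
  | zero =>
    refine ⟨0, by simp, ?_⟩
    intro w hw
    simpa using hw
  | succ j ih =>
    obtain ⟨t, ht, hL⟩ := ih
    have e : (k ^ (n + j)) y = (k ^ j) ((k ^ n) y) := by
      rw [← Equiv.Perm.mul_apply, ← pow_add, add_comm]
    have h1 := hs (n + j)
    have h2 := hn (n + (j + 1)) (by omega)
    have h3 := (hM ((k ^ (n + j)) y)).ext t
    rw [e] at h3 h1
    have h4 := hL.comp h3
    have e2 : (fun w => k ((k ^ j) w)) = ⇑(k ^ (j + 1)) := by
      funext w; rw [pow_succ', Equiv.Perm.mul_apply]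
    rw [e2] at h4
    rw [← add_assoc] at h2 ⊢
    refine ⟨M ((k ^ j) ((k ^ n) y)) + t - D, by omega, ?_⟩
    convert h4 using 1
    omega

lemma pump_bw {k : Equiv.Perm Cantor} {D : ℕ} {M : Cantor → ℕ} (hM : ∀ x, Loc k x D (M x))
    {y : Cantor} {s : ℕ → ℤ} (hs : ∀ n, s (n + 1) = s n + (M ((k ^ n) y) - D))
    {n : ℕ} (hn : ∀ j, j ≤ n → s n ≤ s j) (j : ℕ) (hj : j ≤ n) :
    ∃ t : ℕ, (t : ℤ) = s (n - j) - s n ∧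
      Loc (k⁻¹ ^ j : Equiv.Perm Cantor) ((k ^ n) y) D (D + t) := by
  induction j with
  | zero =>
    refine ⟨0, by simp, ?_⟩
    intro w hw
    simpa using hw
  | succ j ih =>
    obtain ⟨t, ht, hL⟩ := ih (by omega)
    obtain ⟨i, hi⟩ : ∃ i, n = i + (j + 1) := ⟨n - (j + 1), by omega⟩
    have e1 : n - j = i + 1 := by omega
    have e2 : n - (j + 1) = i := by omega
    have h1 := hs i
    have h2 := hn i (by omega)
    rw [e1] at ht
    rw [e2]
    have e : k ((k ^ i) y) = (k⁻¹ ^ j) ((k ^ n) y) := by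
      rw [← Equiv.Perm.mul_apply, ← Equiv.Perm.mul_apply]
      congr 1
      rw [hi, show i + (j + 1) = j + (i + 1) by ring, pow_add, ← mul_assoc, inv_pow,
        inv_mul_cancel, one_mul, pow_succ']
    obtain ⟨r, hr⟩ : ∃ r : ℕ, (r : ℤ) = s i - s n := ⟨(s i - s n).toNat, by omega⟩
    have h3 := (hM ((k ^ i) y)).inv.ext r
    rw [e, show M ((k ^ i) y) + r = D + t by omega] at h3
    have h4 := hL.comp h3
    have e2 : (fun w => (k⁻¹ : Equiv.Perm Cantor) ((k⁻¹ ^ j) w)) = ⇑(k⁻¹ ^ (j + 1)) := by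
      funext w; rw [pow_succ' (k⁻¹) j, Equiv.Perm.mul_apply]
    rw [e2] at h4
    exact ⟨r, hr, h4⟩

lemma pigeon {P : ℕ → Prop} (hP : ∀ N, ∃ n, N ≤ n ∧ P n) (D : ℕ) (x : ℕ → Cantor) :
    ∃ n n', n < n' ∧ P n ∧ P n' ∧ Agr D (x n') (x n) := by
  have hinf : {n | P n}.Infinite := by
    rw [Set.infinite_iff_exists_gt]
    intro a
    obtain ⟨n, hn, h⟩ := hP (a + 1)
    exact ⟨n, h, by omega⟩
  obtain ⟨n, hn, n', hn', hne, he⟩ := hinf.exists_ne_map_eq_of_mapsTo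
    (f := fun n => (fun i : Fin D => x n i)) (t := Set.univ) (fun _ _ => mem_univ _)
    (Set.toFinite _)
  have hA : Agr D (x n') (x n) := fun i hi => (congrFun he ⟨i, hi⟩).symm
  rcases lt_or_gt_of_ne hne with h | h
  · exact ⟨n, n', h, hn, hn', hA⟩
  · exact ⟨n', n, h, hn', hn, hA.symm⟩

lemma pump {k : Equiv.Perm Cantor} (H : ∀ x, ∃ N M, Loc k x N M) (y : Cantor) :
    ∃ (n : ℕ) (e : ℤ) (D t : ℕ), e ≠ 0 ∧
      Loc (k ^ e : Equiv.Perm Cantor) ((k ^ n) y) D (D + t) ∧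
      Agr D ((k ^ e) ((k ^ n) y)) ((k ^ n) y) := by
  obtain ⟨D, hD⟩ := unif H
  choose M hM using hD
  set s : ℕ → ℤ := fun n => ∑ i ∈ Finset.range n, ((M ((k ^ i) y) : ℤ) - D) with hsdef
  have hs : ∀ n, s (n + 1) = s n + (M ((k ^ n) y) - D) := fun n => by
    simp only [hsdef, Finset.sum_range_succ]
  by_cases hb : ∃ B, ∀ n, B ≤ s n
  · obtain ⟨B, hB⟩ := hb
    have hP : ∀ N, ∃ n, N ≤ n ∧ ∀ j, n ≤ j → s n ≤ s j := by
      intro N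
      obtain ⟨m, ⟨n, hn, rfl⟩, hmin⟩ := Int.exists_least_of_bdd
        (P := fun m => ∃ n, N ≤ n ∧ s n = m) ⟨B, fun z ⟨n, _, hz⟩ => hz ▸ hB n⟩ ⟨_, N, le_rfl, rfl⟩
      exact ⟨n, hn, fun j hj => hmin _ ⟨j, by omega, rfl⟩⟩
    obtain ⟨n, n', hlt, hn, hn', hA⟩ := pigeon hP D (fun n => (k ^ n) y)
    obtain ⟨j, rfl⟩ := Nat.exists_eq_add_of_lt hlt
    obtain ⟨t, -, ht⟩ := pump_fw hM hs hn (j + 1)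
    refine ⟨n, ((j + 1 : ℕ) : ℤ), D, t, by omega, by rwa [zpow_natCast], ?_⟩
    rw [zpow_natCast, ← Equiv.Perm.mul_apply, ← pow_add]
    rwa [show n + j + 1 = j + 1 + n by ring] at hA
  · push Not at hb
    have hP : ∀ N, ∃ n, N ≤ n ∧ ∀ j, j ≤ n → s n ≤ s j := by
      intro N
      obtain ⟨B, hB⟩ : ∃ B, ∀ j, j ≤ N → B ≤ s j := by
        obtain ⟨B, hB⟩ := ((Set.finite_Iic N).image s).bddBelow
        exact ⟨B, fun j hj => hB ⟨j, hj, rfl⟩⟩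
      classical
      have hex := hb B
      refine ⟨Nat.find hex, ?_, ?_⟩
      · by_contra hlt
        have h1 := hB (Nat.find hex) (by omega)
        have h2 := Nat.find_spec hex
        omega
      · intro j hj
        rcases hj.lt_or_eq with h | h
        · have h1 := Nat.find_min hex h
          have h2 := Nat.find_spec hex
          omega
        · rw [h]
    obtain ⟨n, n', hlt, hn, hn', hA⟩ := pigeon hP D (fun n => (k ^ n) y)
    obtain ⟨j, rfl⟩ := Nat.exists_eq_add_of_lt hlt
    obtain ⟨t, -, ht⟩ := pump_bw hM hs hn' (j + 1) (by omega)
    have e : k ^ (-((j + 1 : ℕ) : ℤ)) = k⁻¹ ^ (j + 1) := by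
      rw [zpow_neg, zpow_natCast, inv_pow]
    refine ⟨n + j + 1, -((j + 1 : ℕ) : ℤ), D, t, by omega, by rwa [e], ?_⟩
    rw [e, ← Equiv.Perm.mul_apply, show n + j + 1 = j + 1 + n by ring, pow_add k, ← mul_assoc, inv_pow,
        inv_mul_cancel, one_mul]
    rw [show n + j + 1 = j + 1 + n by ring, pow_add k] at hA
    exact hA.symm

section ctr

variable {f : Equiv.Perm Cantor} {z : Cantor} {D t : ℕ}

lemma ctr_maps (hL : Loc f z D (D + t)) (hA : Agr D (f z) z) {y : Cantor} (hy : Agr D y z) :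
    Agr D (f y) z := ((hL y hy).1.mono (by omega)).trans hA

lemma ctr_maps_iter (hL : Loc f z D (D + t)) (hA : Agr D (f z) z) {y : Cantor} (hy : Agr D y z)
    (i : ℕ) : Agr D ((f ^ i) y) z := by
  induction i with
  | zero => simpa using hy
  | succ i ih => rw [pow_succ', Equiv.Perm.mul_apply]; exact ctr_maps hL hA ih

lemma ctr_iter (hL : Loc f z D (D + t)) (hA : Agr D (f z) z) (ht : 0 < t) {y y' : Cantor}
    (hy : Agr D y z) (hy' : Agr D y' z) (i : ℕ) : Agr (D + i) ((f ^ i) y) ((f ^ i) y') := by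
  induction i with
  | zero => simpa using hy.trans hy'.symm
  | succ i ih =>
    rw [pow_succ', Equiv.Perm.mul_apply, Equiv.Perm.mul_apply]
    have h1 := (hL.transfer (ctr_maps_iter hL hA hy' i)).ext i
    exact (h1 _ ih).1.mono (by omega)

lemma ctr_fix (hL : Loc f z D (D + t)) (hA : Agr D (f z) z) (ht : 0 < t) :
    ∃ x, Agr D x z ∧ f x = x ∧ ∀ y, Agr D y z → ∀ i, Agr (D + i) ((f ^ i) y) x := by
  set x : Cantor := fun j => (f ^ (j + 1)) z j with hx
  have hc : ∀ i d, Agr (D + i) ((f ^ (i + d)) z) ((f ^ i) z) := by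
    intro i d
    rw [pow_add, Equiv.Perm.mul_apply]
    exact ctr_iter hL hA ht (ctr_maps_iter hL hA Agr.rfl' d) Agr.rfl' i
  have hxi : ∀ i, Agr (D + i) x ((f ^ i) z) := by
    intro i j hj
    rcases le_total i (j + 1) with h | h
    · obtain ⟨d, hd⟩ := Nat.exists_eq_add_of_le h
      have := hc i d j hj
      rw [← hd] at this
      exact this
    · obtain ⟨d, rfl⟩ := Nat.exists_eq_add_of_le h
      exact (hc (j + 1) d j (by omega)).symm
  have hxz : Agr D x z := by simpa using hxi 0
  have hfx : f x = x := by
    funext j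
    have h1 := (hL.transfer (ctr_maps_iter hL hA Agr.rfl' j)).ext j
    have h2 := (h1 _ (hxi j)).1 j (by omega)
    rw [← Equiv.Perm.mul_apply, ← pow_succ'] at h2
    exact h2
  refine ⟨x, hxz, hfx, fun y hy i => ?_⟩
  have h1 := ctr_iter hL hA ht hy hxz i
  have h2 : (f ^ i) x = x := by
    induction i with
    | zero => rfl
    | succ i ih => rw [pow_succ, Equiv.Perm.mul_apply, hfx]; exact ih (ctr_iter hL hA ht hy hxz i)
  rwa [h2] at h1

end ctr

/-- Points where all powers have non-trivial germ. -/
def Sinf (k : Equiv.Perm Cantor) : Set Cantor := {y | ∀ e : ℤ, e ≠ 0 → ¬ Triv (k ^ e) y}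

/-- Hyperbolic periodic points. -/
def Hyp (k : Equiv.Perm Cantor) : Set Cantor := {x | (∃ e : ℤ, e ≠ 0 ∧ (k ^ e) x = x) ∧ x ∈ Sinf k}

lemma agr_all_eq {x y : Cantor} (h : ∀ i, Agr i y x) : y = x :=
  funext fun i => h (i + 1) i (by omega)

lemma dyn {k : Equiv.Perm Cantor} (H : ∀ x, ∃ N M, Loc k x N M) (y : Cantor) :
    ∃ (n : ℕ) (e : ℤ) (D : ℕ), e ≠ 0 ∧ ((∀ x, Agr D x ((k ^ n) y) → (k ^ e) x = x) ∨
      ∃ x ∈ Hyp k, ∀ w, Agr D w ((k ^ n) y) → ∀ i, Agr (D + i) (((k ^ e) ^ i) w) x) := by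
  obtain ⟨n, e, D, t, he, hL, hA⟩ := pump H y
  refine ⟨n, e, D, he, ?_⟩
  rcases Nat.eq_zero_or_pos t with rfl | ht
  · left
    intro x hx
    have h1 := hL x hx
    rw [add_zero] at h1
    funext i
    by_cases hi : i < D
    · rw [h1.1 i hi, hA i hi, hx i hi]
    · obtain ⟨j, rfl⟩ := Nat.exists_eq_add_of_le (not_lt.mp hi)
      exact h1.2 j
  · right
    obtain ⟨x, hxz, hfx, hx⟩ := ctr_fix hL hA ht
    refine ⟨x, ⟨⟨e, he, hfx⟩, ?_⟩, hx⟩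
    intro e' he' hT
    obtain ⟨m, hm, hTm⟩ : ∃ m : ℕ, 0 < m ∧ Triv ((k ^ e') ^ m) x ∧
        ∃ q : ℕ, 0 < q ∧ ((k ^ e') ^ m = (k ^ e) ^ q ∨ (k ^ e') ^ m = ((k ^ e) ^ q)⁻¹) := by
      refine ⟨e.natAbs, by omega, hT.pow _, e'.natAbs, by omega, ?_⟩
      have e1 : (k ^ e') ^ e.natAbs = k ^ (e' * e.natAbs) := by rw [zpow_mul, zpow_natCast]
      have e2 : (k ^ e) ^ e'.natAbs = k ^ (e * e'.natAbs) := by rw [zpow_mul, zpow_natCast]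
      rw [e1, e2, ← zpow_neg]
      have : e' * (e.natAbs : ℤ) = e * e'.natAbs ∨ e' * (e.natAbs : ℤ) = -(e * e'.natAbs) := by
        rcases Int.natAbs_eq e with h | h <;> rcases Int.natAbs_eq e' with h' | h' <;>
          generalize e.natAbs = a at * <;> generalize e'.natAbs = b at * <;> subst h h'
        · left; ring
        · right; ring
        · right; ring
        · left; ring
      rcases this with h | h
      · left; rw [h]
      · right; rw [h]
    obtain ⟨hTm, q, hq, hqq⟩ := hTm
    have hTq : Triv ((k ^ e) ^ q) x := by
      rcases hqq with h | h
      · rwa [h] at hTm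
      · rw [h] at hTm; simpa using hTm.inv
    obtain ⟨K, hK⟩ := nhds_agr hTq
    obtain ⟨w, hw, hwx⟩ := exists_agr_ne (K + D) x
    apply hwx
    have hwq : ((k ^ e) ^ q) w = w := hK w (hw.mono (by omega))
    have hwi : ∀ i, (((k ^ e) ^ q) ^ i) w = w := by
      intro i
      induction i with
      | zero => rfl
      | succ i ih => rw [pow_succ, Equiv.Perm.mul_apply, hwq, ih]
    apply agr_all_eq
    intro i
    have h1 := hx w ((hw.mono (by omega)).trans hxz) (q * i)
    rw [pow_mul, hwi] at h1
    exact h1.mono (by nlinarith)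


section action

variable {G : Type*} [Group G] (ι : G →* Equiv.Perm Cantor)

/-- Every element of the group acts locally by prefix replacements. -/
def AllLoc : Prop := ∀ g x, ∃ N M, Loc (ι g) x N M

variable {ι}

lemma cont (hV : AllLoc ι) (g : G) : Continuous (ι g) := by
  rw [continuous_iff_continuousAt]
  intro x
  obtain ⟨N, M, h⟩ := hV g x
  exact h.continuousAt

lemma triv_conj (hV : AllLoc ι) {g h : G} {x : Cantor} (H : Triv (ι h) x) : Triv (ι (g * h * g⁻¹)) (ι g x) := by
  have := H.conj (g := ι g) (by rw [← map_inv]; exact (cont hV g⁻¹).continuousAt)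
  simpa using this

lemma triv_conj' (hV : AllLoc ι) {g h : G} {x : Cantor} (H : Triv (ι (g * h * g⁻¹)) (ι g x)) : Triv (ι h) x := by
  have := triv_conj hV (g := g⁻¹) H
  have e : ι g⁻¹ (ι g x) = x := by rw [map_inv]; simp
  rw [e] at this
  convert this using 2
  group

lemma triv_conj_comm (hV : AllLoc ι) {g h : G} {x : Cantor} (hc : Commute g h) (H : Triv (ι h) (ι g x)) :
    Triv (ι h) x := by
  apply triv_conj' hV (g := g)
  rwa [hc.eq, mul_inv_cancel_right]

lemma sinf_conj (hV : AllLoc ι) {g k : G} {x : Cantor} (H : x ∈ Sinf (ι k)) :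
    ι g x ∈ Sinf (ι (g * k * g⁻¹)) := by
  intro e he hT
  apply H e he
  rw [← map_zpow] at hT ⊢
  apply triv_conj' hV (g := g)
  rwa [conj_zpow] at hT

lemma sinf_pow (hV : AllLoc ι) {k : G} {x : Cantor} (n : ℤ) (H : x ∈ Sinf (ι k)) :
    ((ι k) ^ n) x ∈ Sinf (ι k) := by
  have := sinf_conj hV (g := k ^ n) H
  rw [map_zpow] at this
  convert this using 2
  rw [(Commute.zpow_self k n).eq, mul_inv_cancel_right]

lemma iter_fix {σ : Equiv.Perm Cantor} {w : Cantor} (h : σ w = w) (i : ℕ) : (σ ^ i) w = w := by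
  induction i with
  | zero => rfl
  | succ i ih => rw [pow_succ, Equiv.Perm.mul_apply, h, ih]

lemma iter_fix_z {σ : Equiv.Perm Cantor} {w : Cantor} (h : σ w = w) (i : ℤ) : (σ ^ i) w = w := by
  cases i with
  | ofNat n => simpa using iter_fix h n
  | negSucc n =>
    rw [zpow_negSucc, Equiv.Perm.inv_eq_iff_eq]
    exact (iter_fix h _).symm

lemma hyp_finite (hV : AllLoc ι) (k : G) : (Hyp (ι k)).Finite := by
  have key : ∀ y, ∃ O ∈ 𝓝 y, (O ∩ Hyp (ι k)).Subsingleton := by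
    intro y
    obtain ⟨n, e, D, he, h⟩ := dyn (hV k) y
    refine ⟨(ι k ^ n) ⁻¹' {w | Agr D w ((ι k ^ n) y)}, ?_, ?_⟩
    · rw [← map_pow]
      exact (cont hV (k ^ n)).continuousAt.preimage_mem_nhds (agr_mem_nhds _ _)
    · rcases h with h | ⟨z, hz, h⟩
      · rintro x ⟨hxO, hx⟩
        exfalso
        have h1 := sinf_pow hV n hx.2
        rw [zpow_natCast] at h1
        apply h1 e he
        refine mem_of_superset (agr_mem_nhds D _) fun w hw => h w (Agr.trans hw hxO)
      · have : ∀ x, x ∈ (ι k ^ n) ⁻¹' {w | Agr D w ((ι k ^ n) y)} ∩ Hyp (ι k) →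
            (ι k ^ n) x = z := by
          rintro x ⟨hxO, ⟨e', he', hx'⟩, -⟩
          set w := (ι k ^ n) x with hw
          have h1 : (ι k ^ e') w = w := by
            rw [hw, ← Equiv.Perm.mul_apply, ← zpow_natCast, ← zpow_add, add_comm, zpow_add,
              Equiv.Perm.mul_apply, hx']
          have h2 : ((ι k ^ e) ^ e'.natAbs) w = w := by
            have : (ι k ^ e') ^ (e'.sign * e) = (ι k ^ e) ^ e'.natAbs := by
              rw [← zpow_mul, ← zpow_natCast (ι k ^ e), ← zpow_mul]
              congr 1
              rw [← mul_assoc, mul_comm e' e'.sign, Int.sign_mul_self_eq_natAbs]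
              ring
            rw [← this]
            exact iter_fix_z h1 _
          apply agr_all_eq
          intro i
          have h3 := h w hxO (e'.natAbs * i)
          rw [pow_mul, iter_fix h2] at h3
          have : 0 < e'.natAbs := by omega
          exact h3.mono (by nlinarith)
        intro x hx x' hx'
        exact (ι k ^ n).injective ((this x hx).trans (this x' hx').symm)
  choose O hO hs using key
  obtain ⟨t, -, ht⟩ := (isCompact_univ (X := Cantor)).elim_nhds_subcover O (fun x _ => hO x)
  refine (t.finite_toSet.biUnion (t := fun y => O y ∩ Hyp (ι k))
    (fun y _ => (hs y).finite)).subset fun x hx => ?_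
  have := ht (mem_univ x)
  simp only [mem_iUnion] at this ⊢
  obtain ⟨y, hy, hxy⟩ := this
  exact ⟨y, hy, hxy, hx⟩

/-- points of `Sinf` are attracted to hyperbolic points -/
lemma sinf_attract (hV : AllLoc ι) (k : G) {y : Cantor} (hy : y ∈ Sinf (ι k)) :
    ∃ x ∈ Hyp (ι k), ∀ U ∈ 𝓝 x, ∃ n : ℤ, ι (k ^ n) y ∈ U := by
  obtain ⟨n, e, D, he, h⟩ := dyn (hV k) y
  rcases h with h | ⟨x, hx, h⟩
  · exfalso
    have h1 := sinf_pow hV n hy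
    rw [zpow_natCast] at h1
    apply h1 e he
    exact mem_of_superset (agr_mem_nhds D _) fun w hw => h w hw
  · refine ⟨x, hx, fun U hU => ?_⟩
    obtain ⟨K, hK⟩ := nhds_agr hU
    refine ⟨e * K + n, hK _ ?_⟩
    have h1 := h _ Agr.rfl' K
    rw [map_zpow, zpow_add, Equiv.Perm.mul_apply, zpow_mul, zpow_natCast, zpow_natCast]
    exact h1.mono (by omega)

lemma triv_of_hyp (hV : AllLoc ι) {k l : G} (hkl : Commute k l) (H : ∀ x ∈ Hyp (ι k), Triv (ι l) x) {y : Cantor}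
    (hy : y ∈ Sinf (ι k)) : Triv (ι l) y := by
  obtain ⟨x, hx, h⟩ := sinf_attract hV k hy
  obtain ⟨n, hn⟩ := h _ ((isOpen_triv (ι l)).mem_nhds (H x hx))
  exact triv_conj_comm hV (hkl.zpow_left n) hn

lemma finite_pow {P : Set Cantor} (hP : P.Finite) {σ : Equiv.Perm Cantor}
    (hσ : ∀ x ∈ P, σ x ∈ P) : ∃ N : ℕ, 0 < N ∧ ∀ x ∈ P, (σ ^ N) x = x := by
  have := hP.to_subtype
  have hinj : Function.Injective (fun x : P => (⟨σ x, hσ x x.2⟩ : P)) := by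
    intro x y h
    simp only [Subtype.mk.injEq] at h
    exact Subtype.ext (σ.injective h)
  set τ : Equiv.Perm P := Equiv.ofBijective _ (Finite.injective_iff_bijective.mp hinj) with hτ
  have hpow : ∀ n (x : P), (((τ ^ n) x : P) : Cantor) = (σ ^ n) x := by
    intro n
    induction n with
    | zero => intro x; rfl
    | succ n ih =>
      intro x
      rw [pow_succ, pow_succ, Equiv.Perm.mul_apply, Equiv.Perm.mul_apply, ih]
      rfl
  refine ⟨orderOf τ, orderOf_pos τ, fun x hx => ?_⟩
  rw [← hpow _ ⟨x, hx⟩, pow_orderOf_eq_one]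
  rfl

/-- degree of a germ -/
def HDeg (σ : Equiv.Perm Cantor) (x : Cantor) (d : ℤ) : Prop :=
  ∃ N M : ℕ, Loc σ x N M ∧ (M : ℤ) - N = d

lemma HDeg.mul {σ τ : Equiv.Perm Cantor} {x : Cantor} {d e : ℤ} (h1 : HDeg σ x d)
    (h2 : HDeg τ x e) (hx : τ x = x) : HDeg (σ * τ) x (d + e) := by
  obtain ⟨N, M, hL, hd⟩ := h1
  obtain ⟨N', M', hL', he⟩ := h2
  have h1 := hL.ext M'
  have h2 := hL'.ext N
  rw [add_comm M' N] at h2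
  have h3 := h2.comp (g := σ) (P := M + M') (by rw [hx]; exact h1)
  exact ⟨_, _, h3, by push_cast; omega⟩

lemma HDeg.inv {σ : Equiv.Perm Cantor} {x : Cantor} {d : ℤ} (h : HDeg σ x d)
    (hx : σ x = x) : HDeg σ⁻¹ x (-d) := by
  obtain ⟨N, M, hL, hd⟩ := h
  have := hL.inv
  rw [hx] at this
  exact ⟨_, _, this, by omega⟩

lemma HDeg.pow {σ : Equiv.Perm Cantor} {x : Cantor} {d : ℤ} (h : HDeg σ x d)
    (hx : σ x = x) (n : ℕ) : HDeg (σ ^ n) x (n * d) := by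
  induction n with
  | zero => exact ⟨0, 0, fun y hy => by simpa using hy, by simp⟩
  | succ n ih =>
    rw [pow_succ]
    convert ih.mul h hx using 1
    push_cast; ring

lemma HDeg.zpow {σ : Equiv.Perm Cantor} {x : Cantor} {d : ℤ} (h : HDeg σ x d)
    (hx : σ x = x) (n : ℤ) : HDeg (σ ^ n) x (n * d) := by
  cases n with
  | ofNat n => simpa using h.pow hx n
  | negSucc n =>
    rw [zpow_negSucc]
    convert (h.pow hx (n + 1)).inv (iter_fix hx _) using 1
    rw [Int.negSucc_eq]; push_cast; ring

lemma HDeg.triv {σ : Equiv.Perm Cantor} {x : Cantor} (h : HDeg σ x 0)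
    (hx : σ x = x) : Triv σ x := by
  obtain ⟨N, M, hL, hd⟩ := h
  have : M = N := by omega
  subst this
  exact triv_of_loc hL hx

lemma hdeg_exists (hV : AllLoc ι) (g : G) (x : Cantor) : ∃ d, HDeg (ι g) x d := by
  obtain ⟨N, M, h⟩ := hV g x
  exact ⟨_, N, M, h, rfl⟩

lemma inv_fix {σ : Equiv.Perm Cantor} {x : Cantor} (h : σ x = x) : σ⁻¹ x = x := by
  rw [Equiv.Perm.inv_eq_iff_eq, h]

lemma germ_comm (hV : AllLoc ι) {p q : G} {x : Cantor} (hp : ι p x = x) (hq : ι q x = x) :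
    Triv (ι ⁅p, q⁆) x := by
  obtain ⟨d, hd⟩ := hdeg_exists hV p x
  obtain ⟨e, he⟩ := hdeg_exists hV q x
  rw [commutatorElement_def, map_mul, map_mul, map_mul, map_inv, map_inv]
  have h1 := ((hd.mul he hq).mul (hd.inv hp) (inv_fix hp)).mul (he.inv hq) (inv_fix hq)
  have h2 : d + e + -d + -e = 0 := by ring
  rw [h2] at h1
  refine h1.triv ?_
  simp only [Equiv.Perm.mul_apply]
  rw [inv_fix hq, inv_fix hp, hq, hp]

/-- two germs at a common fixed point are multiplicatively dependent -/
lemma germ_dep (hV : AllLoc ι) {p q : G} {x : Cantor} (hp : ι p x = x) (hq : ι q x = x) :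
    ∃ i j : ℤ, (i ≠ 0 ∨ j ≠ 0) ∧ Triv (ι (p ^ i * q ^ j)) x := by
  obtain ⟨d, hd⟩ := hdeg_exists hV p x
  obtain ⟨e, he⟩ := hdeg_exists hV q x
  by_cases hd0 : d = 0
  · subst hd0
    exact ⟨1, 0, Or.inl one_ne_zero, by simpa using hd.triv hp⟩
  · refine ⟨e, -d, Or.inr (by simpa using hd0), ?_⟩
    rw [map_mul, map_zpow, map_zpow]
    have h1 := (hd.zpow hp e).mul (he.zpow hq (-d)) (iter_fix_z hq _)
    have h2 : e * d + -d * e = 0 := by ring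
    rw [h2] at h1
    refine h1.triv ?_
    rw [Equiv.Perm.mul_apply, iter_fix_z hq, iter_fix_z hp]

/-- The elements acting trivially near `X`. -/
def NX (ι : G →* Equiv.Perm Cantor) (X : Set Cantor) : Subgroup G where
  carrier := {g | ∀ x ∈ X, Triv (ι g) x}
  mul_mem' := fun {a b} ha hb x hx => by rw [map_mul]; exact (ha x hx).mul (hb x hx)
  one_mem' := fun x _ => by rw [map_one]; exact triv_one x
  inv_mem' := fun {a} ha x hx => by rw [map_inv]; exact (ha x hx).inv

lemma NX_normal (hV : AllLoc ι) {X : Set Cantor} (hX : ∀ g : G, ∀ x ∈ X, ι g x ∈ X) :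
    (NX ι X).Normal := by
  refine ⟨fun n hn g x hx => ?_⟩
  have h1 := triv_conj hV (g := g) (hn _ (hX g⁻¹ x hx))
  have e : ι g (ι g⁻¹ x) = x := by rw [map_inv]; simp
  rwa [e] at h1

lemma comm_mem_iff {N : Subgroup G} [N.Normal] {a b : G} :
    ⁅a, b⁆ ∈ N ↔ Commute (a : G ⧸ N) (b : G ⧸ N) := by
  rw [← commutatorElement_eq_one_iff_commute, ← QuotientGroup.eq_one_iff]
  rfl

lemma hyp_inv (hV : AllLoc ι) {X : Set Cantor} (hX : ∀ g : G, ∀ x ∈ X, ι g x ∈ X) {g k : G}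
    (hgk : ⁅g, k⁆ ∈ NX ι X) {x : Cantor} (hx : x ∈ Hyp (ι k)) (hxX : x ∈ X) :
    ι g x ∈ Hyp (ι k) := by
  have := NX_normal hV hX
  have hn : ∀ e : ℤ, ⁅g, k ^ e⁆ ∈ NX ι X := by
    intro e
    rw [comm_mem_iff] at hgk ⊢
    exact hgk.zpow_right e
  have hfac : ∀ e : ℤ, g * k ^ e * g⁻¹ = ⁅g, k ^ e⁆ * k ^ e := by
    intro e; rw [commutatorElement_def]; group
  obtain ⟨⟨e, he, hxe⟩, hS⟩ := hx
  refine ⟨⟨e, he, ?_⟩, fun e' he' hT => hS e' he' ?_⟩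
  · have h2 : k ^ e * g = ⁅g, k ^ e⁆⁻¹ * (g * k ^ e) := by rw [commutatorElement_def]; group
    rw [← map_zpow, ← Equiv.Perm.mul_apply, ← map_mul, h2, map_mul, map_mul, Equiv.Perm.mul_apply,
      Equiv.Perm.mul_apply, map_zpow, hxe]
    exact ((NX ι X).inv_mem (hn e) _ (hX g x hxX)).self
  · rw [← map_zpow] at hT ⊢
    apply triv_conj' hV (g := g)
    rw [hfac, map_mul]
    exact (hn e' _ (hX g x hxX)).mul hT

lemma hyp_inv' (hV : AllLoc ι) {g k : G} (hgk : Commute g k) {x : Cantor} (hx : x ∈ Hyp (ι k)) :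
    ι g x ∈ Hyp (ι k) := by
  refine hyp_inv hV (X := univ) (fun _ _ _ => mem_univ _) ?_ hx (mem_univ x)
  rw [commutatorElement_eq_one_iff_commute.mpr hgk]
  exact one_mem _

lemma comm_trick {u v w : G} (h1 : Commute (w * u * w⁻¹) v)
    (h2 : Commute (w ^ 2 * u * (w ^ 2)⁻¹) v) : ⁅⁅u, w⁆, ⁅v, w⁻¹⁆⁆ = ⁅u, v⁆ := by
  set U := w * u * w⁻¹ with hU
  set V := w⁻¹ * v * w with hVd
  have hUV : Commute U V := by
    have := h2.map (MulAut.conj w⁻¹).toMonoidHom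
    simp only [MulEquiv.toMonoidHom_eq_coe, MonoidHom.coe_coe, MulAut.conj_apply, inv_inv] at this
    convert this using 1
    rw [hU]; group
  have huV : Commute u V := by
    have := h1.map (MulAut.conj w⁻¹).toMonoidHom
    simp only [MulEquiv.toMonoidHom_eq_coe, MonoidHom.coe_coe, MulAut.conj_apply, inv_inv] at this
    convert this using 1
    rw [hU]; group
  have e1 : ⁅u, w⁆ = u * U⁻¹ := by rw [commutatorElement_def, hU]; group
  have e2 : ⁅v, w⁻¹⁆ = v * V⁻¹ := by rw [commutatorElement_def, hVd]; group
  rw [e1, e2, commutatorElement_def, commutatorElement_def]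
  have c1 : U⁻¹ * (v * V⁻¹) * U = v * V⁻¹ := by
    have : Commute U⁻¹ (v * V⁻¹) := (h1.mul_right hUV.inv_right).inv_left
    rw [this.eq, inv_mul_cancel_right]
  have c2 : V⁻¹ * u⁻¹ * V = u⁻¹ := by
    have : Commute V⁻¹ u⁻¹ := huV.symm.inv_inv
    rw [this.eq, inv_mul_cancel_right]
  calc u * U⁻¹ * (v * V⁻¹) * (u * U⁻¹)⁻¹ * (v * V⁻¹)⁻¹
      = u * (U⁻¹ * (v * V⁻¹) * U) * u⁻¹ * V * v⁻¹ := by group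
    _ = u * v * (V⁻¹ * u⁻¹ * V) * v⁻¹ := by rw [c1]; group
    _ = _ := by rw [c2]

/-- Disjointness of supports. -/
lemma disj (hV : AllLoc ι) {k u v g : G} (hu : Commute k u) (hv : Commute k v) (hg : Commute k g)
    (hd : ∀ n : ℕ, 0 < n → Commute (g ^ n * u * (g ^ n)⁻¹) v) {y : Cantor}
    (hy : y ∈ Sinf (ι k)) : Triv (ι ⁅u, v⁆) y := by
  obtain ⟨N, hN, hfix⟩ := finite_pow (hyp_finite hV k) (σ := ι g)
    (fun x hx => hyp_inv' hV hg.symm hx)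
  set w := g ^ N with hw
  have hwfix : ∀ x ∈ Hyp (ι k), ι w x = x := by
    intro x hx; rw [hw, map_pow]; exact hfix x hx
  have hcu : ∀ {a b : G}, Commute k a → (∀ x ∈ Hyp (ι k), ι b x = x) →
      ∀ x ∈ Hyp (ι k), ι ⁅a, b⁆ x = x := by
    intro a b ha hb x hx
    have h1 : ι b⁻¹ x = x := by rw [map_inv]; exact inv_fix (hb x hx)
    have h2 : ι a⁻¹ x ∈ Hyp (ι k) := hyp_inv' hV ha.symm.inv_left hx
    rw [commutatorElement_def, map_mul, map_mul, map_mul, Equiv.Perm.mul_apply,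
      Equiv.Perm.mul_apply, Equiv.Perm.mul_apply, h1, hb _ h2, map_inv]
    simp
  rw [← comm_trick (w := w) (hd N hN) (by rw [hw, ← pow_mul]; exact hd _ (by omega))]
  have hwi : ∀ x ∈ Hyp (ι k), ι w⁻¹ x = x := by
    intro x hx; rw [map_inv]; exact inv_fix (hwfix x hx)
  have hkw : Commute k w := hg.pow_right N
  refine triv_of_hyp hV ?_ (fun x hx => germ_comm hV (hcu hu hwfix x hx) (hcu hv hwi x hx)) hy
  rw [commutatorElement_def, commutatorElement_def, commutatorElement_def]
  have h1 : Commute k (u * w * u⁻¹ * w⁻¹) :=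
    ((hu.mul_right hkw).mul_right hu.inv_right).mul_right hkw.inv_right
  have h2 : Commute k (v * w⁻¹ * v⁻¹ * w⁻¹⁻¹) :=
    ((hv.mul_right hkw.inv_right).mul_right hv.inv_right).mul_right hkw.inv_right.inv_right
  exact ((h1.mul_right h2).mul_right h1.inv_right).mul_right h2.inv_right

lemma unif_triv {K : Set Cantor} (hK : IsCompact K) {k : G}
    (H : ∀ x ∈ K, x ∉ Sinf (ι k)) : ∃ m : ℕ, 0 < m ∧ ∀ x ∈ K, Triv (ι (k ^ m)) x := by
  have key : ∀ x ∈ K, ∃ m : ℕ, 0 < m ∧ Triv (ι (k ^ m)) x := by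
    intro x hx
    have := H x hx
    simp only [Sinf, mem_ofPred_eq, not_forall, not_not] at this
    obtain ⟨e, he, hT⟩ := this
    refine ⟨e.natAbs, by omega, ?_⟩
    rw [map_pow]
    rcases Int.natAbs_eq e with h | h
    · rw [h, zpow_natCast] at hT; exact hT
    · rw [h, zpow_neg, zpow_natCast] at hT; simpa using hT.inv
  choose! m hm hT using key
  obtain ⟨t, htK, ht⟩ := hK.elim_nhds_subcover (fun x => {y | Triv (ι (k ^ (m x))) y})
    (fun x hx => (isOpen_triv _).mem_nhds (hT x hx))
  refine ⟨∏ x ∈ t, m x, Finset.prod_pos fun x hx => hm x (htK x hx), fun x hx => ?_⟩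
  have := ht hx
  simp only [mem_iUnion] at this
  obtain ⟨z, hz, hxz⟩ := this
  obtain ⟨c, hc⟩ := Finset.dvd_prod_of_mem m hz
  rw [hc, pow_mul, map_pow]
  exact Triv.pow hxz c

/-- Lemma M -/
lemma dep_of_sinf (hV : AllLoc ι) {X : Set Cantor} (hXc : IsClosed X) (hX : ∀ g : G, ∀ x ∈ X, ι g x ∈ X)
    {k a b : G} (ha : ⁅a, k⁆ ∈ NX ι X) (hb : ⁅b, k⁆ ∈ NX ι X) {x : Cantor} (hx : x ∈ X)
    (hxk : x ∈ Sinf (ι k)) :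
    ∃ x ∈ X, ∃ i j : ℤ, (i ≠ 0 ∨ j ≠ 0) ∧ Triv (ι (a ^ i * b ^ j)) x := by
  obtain ⟨z, hz, hzn⟩ := sinf_attract hV k hxk
  have hzX : z ∈ X := by
    rw [← hXc.closure_eq, mem_closure_iff_nhds]
    intro U hU
    obtain ⟨n, hn⟩ := hzn U hU
    exact ⟨_, hn, hX _ _ hx⟩
  have hfin : (Hyp (ι k) ∩ X).Finite := (hyp_finite hV k).subset inter_subset_left
  obtain ⟨p, hp, hpf⟩ := finite_pow hfin (σ := ι a)
    (fun x hx => ⟨hyp_inv hV hX ha hx.1 hx.2, hX a x hx.2⟩)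
  obtain ⟨q, hq, hqf⟩ := finite_pow hfin (σ := ι b)
    (fun x hx => ⟨hyp_inv hV hX hb hx.1 hx.2, hX b x hx.2⟩)
  obtain ⟨i, j, hij, hT⟩ := germ_dep hV (p := a ^ p) (q := b ^ q) (x := z)
    (by rw [map_pow]; exact hpf z ⟨hz, hzX⟩) (by rw [map_pow]; exact hqf z ⟨hz, hzX⟩)
  refine ⟨z, hzX, p * i, q * j, ?_, ?_⟩
  · rcases hij with h | h
    · left; positivity
    · right; positivity
  · rw [zpow_mul, zpow_mul, zpow_natCast, zpow_natCast]; exact hT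

lemma exists_dep (hV : AllLoc ι) {X : Set Cantor} (hXc : IsClosed X) (hXne : X.Nonempty)
    (hX : ∀ g : G, ∀ x ∈ X, ι g x ∈ X) {a b : G}
    (ha : ⁅a, ⁅a, b⁆⁆ ∈ NX ι X) (hb : ⁅b, ⁅a, b⁆⁆ ∈ NX ι X) :
    ∃ x ∈ X, ∃ i j : ℤ, (i ≠ 0 ∨ j ≠ 0) ∧ Triv (ι (a ^ i * b ^ j)) x := by
  have := NX_normal hV hX
  by_cases h1 : ∃ x ∈ X, x ∈ Sinf (ι ⁅a, b⁆)
  · obtain ⟨x, hx, hxS⟩ := h1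
    exact dep_of_sinf hV hXc hX ha hb hx hxS
  push Not at h1
  obtain ⟨m, hm, hmT⟩ := unif_triv hXc.isCompact h1
  have hmN : ⁅a, b⁆ ^ m ∈ NX ι X := hmT
  have hcomm : ⁅b, a ^ m⁆ ∈ NX ι X := by
    rw [comm_mem_iff] at ha hb ⊢
    rw [← QuotientGroup.eq_one_iff] at hmN
    set A : G ⧸ NX ι X := (a : G ⧸ NX ι X)
    set B : G ⧸ NX ι X := (b : G ⧸ NX ι X)
    have hC : ((⁅a, b⁆ : G) : G ⧸ NX ι X) = ⁅A, B⁆ := rfl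
    rw [QuotientGroup.mk_pow, hC] at hmN
    rw [hC] at ha hb
    rw [QuotientGroup.mk_pow]
    change Commute B (A ^ m)
    have h2 : ∀ n : ℕ, A ^ n * B = B * A ^ n * ⁅A, B⁆ ^ n := by
      have h3 : A * B = B * A * ⁅A, B⁆ := by
        have : A * B = ⁅A, B⁆ * (B * A) := by rw [commutatorElement_def]; group
        rw [this]
        exact ((hb.mul_left ha).eq).symm
      intro n
      induction n with
      | zero => simp
      | succ n ih =>
        have h4 : Commute ⁅A, B⁆ (A ^ n) := (ha.pow_left n).symm
        calc A ^ (n + 1) * B = A ^ n * (A * B) := by rw [pow_succ, mul_assoc]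
          _ = (A ^ n * B) * (A * ⁅A, B⁆) := by rw [h3]; group
          _ = B * A ^ n * (⁅A, B⁆ ^ n * A) * ⁅A, B⁆ := by rw [ih]; group
          _ = B * A ^ n * (A * ⁅A, B⁆ ^ n) * ⁅A, B⁆ := by rw [(ha.pow_right n).eq]
          _ = _ := by rw [pow_succ, pow_succ]; group
    have := h2 m
    rw [hmN, mul_one] at this
    exact this.symm
  by_cases h2 : ∃ x ∈ X, x ∈ Sinf (ι (a ^ m))
  · obtain ⟨x, hx, hxS⟩ := h2
    obtain ⟨x', hx', i, j, hij, hT⟩ := dep_of_sinf hV hXc hX (a := a ^ m) (k := a ^ m)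
      (by rw [commutatorElement_self]; exact one_mem _) hcomm hx hxS
    refine ⟨x', hx', m * i, j, ?_, ?_⟩
    · rcases hij with h | h
      · left; positivity
      · right; exact h
    · rw [zpow_mul, zpow_natCast]; exact hT
  · push Not at h2
    obtain ⟨p, hp, hpT⟩ := unif_triv hXc.isCompact h2
    obtain ⟨x, hx⟩ := hXne
    refine ⟨x, hx, m * p, 0, Or.inl (by positivity), ?_⟩
    rw [zpow_mul, zpow_natCast, zpow_natCast, zpow_zero, mul_one]
    exact hpT x hx

end action

section pl

/-- identity to the left of `δ` -/
def FixL (f : Equiv.Perm ℝ) (δ : ℝ) : Prop := ∀ x, x ≤ δ → f x = x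

/-- identity to the right of `ε` -/
def FixR (f : Equiv.Perm ℝ) (ε : ℝ) : Prop := ∀ x, ε ≤ x → f x = x

/-- linear with slope `μ` to the right of zero -/
def Lin (f : Equiv.Perm ℝ) (μ : ℝ) : Prop := 0 < μ ∧ ∃ ρ > 0, ∀ x, 0 ≤ x → x ≤ ρ → f x = μ * x

lemma FixL.mono {f : Equiv.Perm ℝ} {δ δ' : ℝ} (h : FixL f δ) (hd : δ' ≤ δ) : FixL f δ' :=
  fun x hx => h x (hx.trans hd)

lemma FixR.mono {f : Equiv.Perm ℝ} {δ δ' : ℝ} (h : FixR f δ) (hd : δ ≤ δ') : FixR f δ' :=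
  fun x hx => h x (hd.trans hx)

lemma FixL.mul {f g : Equiv.Perm ℝ} {δ : ℝ} (hf : FixL f δ) (hg : FixL g δ) : FixL (f * g) δ :=
  fun x hx => by rw [Equiv.Perm.mul_apply, hg x hx, hf x hx]

lemma FixR.mul {f g : Equiv.Perm ℝ} {δ : ℝ} (hf : FixR f δ) (hg : FixR g δ) : FixR (f * g) δ :=
  fun x hx => by rw [Equiv.Perm.mul_apply, hg x hx, hf x hx]

lemma FixL.inv {f : Equiv.Perm ℝ} {δ : ℝ} (hf : FixL f δ) : FixL f⁻¹ δ :=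
  fun x hx => by rw [Equiv.Perm.inv_eq_iff_eq, hf x hx]

lemma FixR.inv {f : Equiv.Perm ℝ} {δ : ℝ} (hf : FixR f δ) : FixR f⁻¹ δ :=
  fun x hx => by rw [Equiv.Perm.inv_eq_iff_eq, hf x hx]

lemma FixR.pow {f : Equiv.Perm ℝ} {δ : ℝ} (hf : FixR f δ) (n : ℕ) : FixR (f ^ n) δ := by
  induction n with
  | zero => exact fun x _ => rfl
  | succ n ih => rw [pow_succ]; exact ih.mul hf

lemma FixL.pow {f : Equiv.Perm ℝ} {δ : ℝ} (hf : FixL f δ) (n : ℕ) : FixL (f ^ n) δ := by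
  induction n with
  | zero => exact fun x _ => rfl
  | succ n ih => rw [pow_succ]; exact ih.mul hf

lemma FixL.comm {f g : Equiv.Perm ℝ} {δ : ℝ} (hf : FixL f δ) (hg : FixL g δ) : FixL ⁅f, g⁆ δ :=
  ((hf.mul hg).mul hf.inv).mul hg.inv

lemma FixR.comm {f g : Equiv.Perm ℝ} {δ : ℝ} (hf : FixR f δ) (hg : FixR g δ) : FixR ⁅f, g⁆ δ :=
  ((hf.mul hg).mul hf.inv).mul hg.inv

lemma Lin.mul {f g : Equiv.Perm ℝ} {μ ν : ℝ} (hf : Lin f μ) (hg : Lin g ν) :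
    Lin (f * g) (μ * ν) := by
  obtain ⟨hμ, ρ, hρ, h1⟩ := hf
  obtain ⟨hν, ρ', hρ', h2⟩ := hg
  refine ⟨by positivity, min ρ' (ρ / ν), by positivity, fun x hx hx' => ?_⟩
  have h3 : ν * x ≤ ρ := by
    have := hx'.trans (min_le_right _ _)
    rw [le_div_iff₀ hν] at this
    linarith
  rw [Equiv.Perm.mul_apply, h2 x hx (hx'.trans (min_le_left _ _)), h1 _ (by positivity) h3]
  ring

lemma Lin.inv {f : Equiv.Perm ℝ} {μ : ℝ} (hf : Lin f μ) : Lin f⁻¹ μ⁻¹ := by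
  obtain ⟨hμ, ρ, hρ, h1⟩ := hf
  refine ⟨by positivity, ρ * μ, by positivity, fun x hx hx' => ?_⟩
  rw [Equiv.Perm.inv_eq_iff_eq, h1 _ (by positivity)]
  · field_simp
  · rw [inv_mul_le_iff₀ hμ]; linarith

lemma lin_one : Lin 1 1 := ⟨one_pos, 1, one_pos, fun x _ _ => by simp⟩

lemma Lin.pow {f : Equiv.Perm ℝ} {μ : ℝ} (hf : Lin f μ) (n : ℕ) : Lin (f ^ n) (μ ^ n) := by
  induction n with
  | zero => simpa using lin_one
  | succ n ih => rw [pow_succ, pow_succ]; exact ih.mul hf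

lemma Lin.zpow {f : Equiv.Perm ℝ} {μ : ℝ} (hf : Lin f μ) (n : ℤ) : Lin (f ^ n) (μ ^ n) := by
  cases n with
  | ofNat n => simpa using hf.pow n
  | negSucc n => rw [zpow_negSucc, zpow_negSucc]; exact (hf.pow _).inv

/-- iterates get below `δ` -/
lemma iter_small {f : Equiv.Perm ℝ} {δ ε c : ℝ} (hc : 0 < c)
    (h : ∀ x, δ ≤ x → x ≤ ε → f x ≤ x - c) : ∃ N : ℕ, (f ^ N) ε < δ := by
  by_contra hcon
  push Not at hcon
  have key : ∀ N : ℕ, (f ^ N) ε ≤ ε - N * c := by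
    intro N
    induction N with
    | zero => simp
    | succ n ih =>
      rw [pow_succ', Equiv.Perm.mul_apply]
      have h0 : 0 ≤ (n : ℝ) * c := by positivity
      have := h _ (hcon n) (by linarith)
      rw [Nat.cast_succ]; linarith
  obtain ⟨N, hN⟩ := exists_nat_gt ((ε - δ) / c)
  rw [div_lt_iff₀ hc] at hN
  have := key N
  have := hcon N
  linarith

/-- contraction with slopes `1/2, 1, 2` on `[0, l]` -/
noncomputable def phi2 (l : ℝ) (hl : 0 < l) : Equiv.Perm ℝ where
  toFun x := if x ≤ 0 then x else if x ≤ l / 2 then x / 2 else if x ≤ 3 * l / 4 then x - l / 4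
    else if x ≤ l then 2 * x - l else x
  invFun y := if y ≤ 0 then y else if y ≤ l / 4 then 2 * y else if y ≤ l / 2 then y + l / 4
    else if y ≤ l then (y + l) / 2 else y
  left_inv x := by
    dsimp only
    split_ifs <;> linarith
  right_inv y := by
    dsimp only
    split_ifs <;> linarith

/-- contraction with slopes `1/3, 1, 3` on `[0, l]` -/
noncomputable def phi3 (l : ℝ) (hl : 0 < l) : Equiv.Perm ℝ where
  toFun x := if x ≤ 0 then x else if x ≤ l / 2 then x / 3 else if x ≤ 5 * l / 6 then x - l / 3
    else if x ≤ l then 3 * x - 2 * l else x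
  invFun y := if y ≤ 0 then y else if y ≤ l / 6 then 3 * y else if y ≤ l / 2 then y + l / 3
    else if y ≤ l then (y + 2 * l) / 3 else y
  left_inv x := by
    dsimp only
    split_ifs <;> linarith
  right_inv y := by
    dsimp only
    split_ifs <;> linarith

lemma phi2_apply (l : ℝ) (hl : 0 < l) (x : ℝ) : phi2 l hl x =
    if x ≤ 0 then x else if x ≤ l / 2 then x / 2 else if x ≤ 3 * l / 4 then x - l / 4
    else if x ≤ l then 2 * x - l else x := rfl

lemma phi3_apply (l : ℝ) (hl : 0 < l) (x : ℝ) : phi3 l hl x =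
    if x ≤ 0 then x else if x ≤ l / 2 then x / 3 else if x ≤ 5 * l / 6 then x - l / 3
    else if x ≤ l then 3 * x - 2 * l else x := rfl

lemma phi2_mono (l : ℝ) (hl : 0 < l) : Monotone (phi2 l hl) := by
  intro x y hxy
  rw [phi2_apply, phi2_apply]
  split_ifs <;> linarith

lemma phi3_mono (l : ℝ) (hl : 0 < l) : Monotone (phi3 l hl) := by
  intro x y hxy
  rw [phi3_apply, phi3_apply]
  split_ifs <;> linarith

lemma phi2_le (l : ℝ) (hl : 0 < l) (x : ℝ) : phi2 l hl x ≤ x := by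
  rw [phi2_apply]
  split_ifs <;> linarith

lemma phi2_fixR (l : ℝ) (hl : 0 < l) : FixR (phi2 l hl) l := by
  intro x hx
  rw [phi2_apply]
  split_ifs <;> linarith

lemma phi3_fixR (l : ℝ) (hl : 0 < l) : FixR (phi3 l hl) l := by
  intro x hx
  rw [phi3_apply]
  split_ifs <;> linarith

lemma phi2_lin (l : ℝ) (hl : 0 < l) : Lin (phi2 l hl) (1 / 2) := by
  refine ⟨by norm_num, l / 2, by positivity, fun x hx hx' => ?_⟩
  rw [phi2_apply]
  split_ifs <;> linarith

lemma phi3_lin (l : ℝ) (hl : 0 < l) : Lin (phi3 l hl) (1 / 3) := by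
  refine ⟨by norm_num, l / 2, by positivity, fun x hx hx' => ?_⟩
  rw [phi3_apply]
  split_ifs <;> linarith

lemma phi2_small (l : ℝ) (hl : 0 < l) {δ ε : ℝ} (hδ : 0 < δ) (hε : ε < l) :
    ∃ N : ℕ, (phi2 l hl ^ N) ε < δ := by
  have h1 : min (δ / 2) (min (l / 4) (l - ε)) ≤ δ / 2 := min_le_left _ _
  have h2 : min (δ / 2) (min (l / 4) (l - ε)) ≤ l / 4 := (min_le_right _ _).trans (min_le_left _ _)
  have h3 : min (δ / 2) (min (l / 4) (l - ε)) ≤ l - ε := (min_le_right _ _).trans (min_le_right _ _)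
  have h4 : 0 < min (δ / 2) (min (l / 4) (l - ε)) := by
    have : 0 < l - ε := by linarith
    positivity
  generalize min (δ / 2) (min (l / 4) (l - ε)) = c at *
  refine iter_small h4 fun x hx hx' => ?_
  rw [phi2_apply]
  split_ifs <;> linarith

lemma mem_sixth {x : ℝ} (z : ℤ) (h : x * 1296 = z) : x ∈ zOneSixth :=
  ⟨z, 4, by rw [← h]; norm_num⟩

lemma two_mem (m k : ℤ) {x : ℝ} (h : x = 2 ^ m * 3 ^ k) : x ∈ twoThreePowers := ⟨m, k, h⟩

lemma bs_of4 {f : Equiv.Perm ℝ} (hm : Monotone f) (hf : ∀ x, x ∉ Set.Icc (0 : ℝ) 1 → f x = x)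
    {p1 p2 p3 : ℝ} (h1 : 0 < p1) (h2 : p1 < p2) (h3 : p2 < p3) (h4 : p3 < 1)
    (m1 : p1 ∈ zOneSixth) (m2 : p2 ∈ zOneSixth) (m3 : p3 ∈ zOneSixth)
    (s1 : ∃ c ∈ twoThreePowers, ∀ x ∈ Set.Icc 0 p1, f x = f 0 + c * (x - 0))
    (s2 : ∃ c ∈ twoThreePowers, ∀ x ∈ Set.Icc p1 p2, f x = f p1 + c * (x - p1))
    (s3 : ∃ c ∈ twoThreePowers, ∀ x ∈ Set.Icc p2 p3, f x = f p2 + c * (x - p2))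
    (s4 : ∃ c ∈ twoThreePowers, ∀ x ∈ Set.Icc p3 1, f x = f p3 + c * (x - p3)) :
    IsBS 0 1 zOneSixth twoThreePowers f := by
  refine ⟨hm, hf, 4,
    fun i => match i with | 0 => 0 | 1 => p1 | 2 => p2 | 3 => p3 | _ => 1,
    rfl, rfl, ?_, ?_, ?_⟩
  · intro i hi
    interval_cases i
    exacts [h1, h2, h3, h4]
  · intro i hi hi'
    interval_cases i
    exacts [m1, m2, m3]
  · intro i hi
    interval_cases i
    exacts [s1, s2, s3, s4]

lemma one_mem_tt : (1 : ℝ) ∈ twoThreePowers := two_mem 0 0 (by norm_num)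

lemma phi2_bs (l : ℝ) (hl : 0 < l) (hl1 : l < 1) (h1 : l / 2 ∈ zOneSixth)
    (h2 : 3 * l / 4 ∈ zOneSixth) (h3 : l ∈ zOneSixth) :
    IsBS 0 1 zOneSixth twoThreePowers (phi2 l hl) := by
  refine bs_of4 (phi2_mono l hl) (fun x hx => ?_) (p1 := l / 2) (p2 := 3 * l / 4) (p3 := l)
    (by linarith) (by linarith) (by linarith) hl1 h1 h2 h3
    ⟨1 / 2, two_mem (-1) 0 (by norm_num), fun x hx => ?_⟩
    ⟨1, one_mem_tt, fun x hx => ?_⟩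
    ⟨2, two_mem 1 0 (by norm_num), fun x hx => ?_⟩
    ⟨1, one_mem_tt, fun x hx => ?_⟩
  · rw [Set.mem_Icc, not_and_or] at hx
    rw [phi2_apply]
    rcases hx with h | h <;> split_ifs <;> linarith
  all_goals
    rw [phi2_apply, phi2_apply]
    obtain ⟨h4, h5⟩ := hx
    split_ifs <;> linarith

lemma phi3_bs (l : ℝ) (hl : 0 < l) (hl1 : l < 1) (h1 : l / 2 ∈ zOneSixth)
    (h2 : 5 * l / 6 ∈ zOneSixth) (h3 : l ∈ zOneSixth) :
    IsBS 0 1 zOneSixth twoThreePowers (phi3 l hl) := by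
  refine bs_of4 (phi3_mono l hl) (fun x hx => ?_) (p1 := l / 2) (p2 := 5 * l / 6) (p3 := l)
    (by linarith) (by linarith) (by linarith) hl1 h1 h2 h3
    ⟨1 / 3, two_mem 0 (-1) (by norm_num), fun x hx => ?_⟩
    ⟨1, one_mem_tt, fun x hx => ?_⟩
    ⟨3, two_mem 0 1 (by norm_num), fun x hx => ?_⟩
    ⟨1, one_mem_tt, fun x hx => ?_⟩
  · rw [Set.mem_Icc, not_and_or] at hx
    rw [phi3_apply]
    rcases hx with h | h <;> split_ifs <;> linarith
  all_goals
    rw [phi3_apply, phi3_apply]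
    obtain ⟨h4, h5⟩ := hx
    split_ifs <;> linarith

lemma slope_nat {m n : ℕ} (h : 2 ^ m = 3 ^ n) : m = 0 := by
  by_contra hm
  have h1 : Even (3 ^ n) := h ▸ (even_two.pow_of_ne_zero hm)
  have h2 : Odd (3 ^ n) := Odd.pow (by decide)
  exact (Nat.not_even_iff_odd.mpr h2) h1

lemma slope_real {m n : ℕ} (h : (2 : ℝ) ^ m = 3 ^ n) : m = 0 :=
  slope_nat (n := n) (by exact_mod_cast h)

lemma slope_real' {m n : ℕ} (h : (2 : ℝ) ^ m * 3 ^ n = 1) : m = 0 := by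
  by_contra hm
  have h1 : (1 : ℝ) < 2 ^ m := one_lt_pow₀ (by norm_num) hm
  have h2 : (1 : ℝ) ≤ 3 ^ n := one_le_pow₀ (by norm_num)
  nlinarith

lemma slope_ne {i j : ℤ} (h : i ≠ 0 ∨ j ≠ 0) : ((1 : ℝ) / 2) ^ i * (1 / 3) ^ j ≠ 1 := by
  intro he
  have h1 : (2 : ℝ) ^ i * 3 ^ j = 1 := by
    rw [one_div, one_div, inv_zpow, inv_zpow, ← mul_inv, inv_eq_one] at he
    exact he
  have hi : i = 0 := by
    obtain ⟨m, rfl | rfl⟩ := i.eq_nat_or_neg <;> obtain ⟨n, rfl | rfl⟩ := j.eq_nat_or_neg <;>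
      simp only [zpow_neg, zpow_natCast] at h1
    · simp [slope_real' h1]
    · have : (2 : ℝ) ^ m = 3 ^ n := by field_simp at h1; exact h1
      simp [slope_real this]
    · have : (2 : ℝ) ^ m = 3 ^ n := by field_simp at h1; exact h1.symm
      simp [slope_real this]
    · rw [← mul_inv, inv_eq_one] at h1
      simp [slope_real' h1]
  subst hi
  rw [zpow_zero, one_mul] at h1
  have := (zpow_eq_one_iff_right₀ (by norm_num : (0 : ℝ) ≤ 3) (by norm_num)).mp h1
  tauto

end pl

section asm

lemma perm_apply_inv (f : Equiv.Perm ℝ) (x : ℝ) : f (f⁻¹ x) = x := f.apply_symm_apply x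

lemma perm_inv_apply (f : Equiv.Perm ℝ) (x : ℝ) : f⁻¹ (f x) = x := f.symm_apply_apply x

lemma comm_of {g k : Equiv.Perm ℝ} (mg : Monotone g) (mk : Monotone k) {δ : ℝ} (hg : FixL g δ)
    (hk : FixR k δ) : Commute g k := by
  refine Equiv.ext fun x => ?_
  rw [Equiv.Perm.mul_apply, Equiv.Perm.mul_apply]
  rcases le_total x δ with h | h
  · have h1 : k x ≤ δ := (mk h).trans_eq (hk δ le_rfl)
    rw [hg x h, hg _ h1]
  · have h1 : δ ≤ g x := (hg δ le_rfl).symm.trans_le (mg h)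
    rw [hk x h, hk _ h1]

lemma mono_inv {f : Equiv.Perm ℝ} (hf : Monotone f) : Monotone (f⁻¹ : Equiv.Perm ℝ) := by
  intro x y hxy
  by_contra h
  have h1 := hf (not_le.mp h).le
  rw [perm_apply_inv, perm_apply_inv] at h1
  exact h (le_of_eq (by rw [le_antisymm hxy h1]))

lemma FixL.conj {u g : Equiv.Perm ℝ} {δ : ℝ} (hu : FixL u δ) (mg : Monotone g) :
    FixL (g * u * g⁻¹) (g δ) := by
  intro x hx
  have h1 := mono_inv mg hx
  rw [perm_inv_apply] at h1
  rw [Equiv.Perm.mul_apply, Equiv.Perm.mul_apply, hu _ h1, perm_apply_inv]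

lemma FixR.conj {u g : Equiv.Perm ℝ} {δ : ℝ} (hu : FixR u δ) (mg : Monotone g) :
    FixR (g * u * g⁻¹) (g δ) := by
  intro x hx
  have h1 := mono_inv mg hx
  rw [perm_inv_apply] at h1
  rw [Equiv.Perm.mul_apply, Equiv.Perm.mul_apply, hu _ h1, perm_apply_inv]

lemma lin_fixL {f : Equiv.Perm ℝ} (h : Lin f 1) (h0 : FixL f 0) : ∃ δ > 0, FixL f δ := by
  obtain ⟨_, ρ, hρ, h1⟩ := h
  refine ⟨ρ, hρ, fun x hx => ?_⟩
  rcases le_total x 0 with h | h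
  · exact h0 x h
  · rw [h1 x h hx, one_mul]

lemma up_iter {f : Equiv.Perm ℝ} (hf : Monotone f) {x : ℝ} (h : x < f x) (n : ℕ) :
    x < (f ^ (n + 1)) x := by
  induction n with
  | zero => simpa using h
  | succ n ih =>
    rw [pow_succ', Equiv.Perm.mul_apply]
    exact h.trans_le (hf ih.le)

lemma down_iter {f : Equiv.Perm ℝ} (hf : Monotone f) {x : ℝ} (h : f x < x) (n : ℕ) :
    (f ^ (n + 1)) x < x := by
  induction n with
  | zero => simpa using h
  | succ n ih =>
    rw [pow_succ', Equiv.Perm.mul_apply]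
    exact (hf ih.le).trans_lt h

lemma torsion_free {f : Equiv.Perm ℝ} (hf : Monotone f) {n : ℕ} (hn : 0 < n) (h : f ^ n = 1) :
    f = 1 := by
  obtain ⟨m, rfl⟩ : ∃ m, n = m + 1 := ⟨n - 1, by omega⟩
  refine Equiv.ext fun x => ?_
  rw [Equiv.Perm.one_apply]
  rcases lt_trichotomy (f x) x with h1 | h1 | h1
  · have := down_iter hf h1 m
    rw [h, Equiv.Perm.one_apply] at this
    exact absurd this (lt_irrefl _)
  · exact h1
  · have := up_iter hf h1 m
    rw [h, Equiv.Perm.one_apply] at this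
    exact absurd this (lt_irrefl _)

lemma phi2_pow_le (l : ℝ) (hl : 0 < l) (n : ℕ) (x : ℝ) : (phi2 l hl ^ n) x ≤ x := by
  induction n with
  | zero => simp
  | succ n ih =>
    rw [pow_succ', Equiv.Perm.mul_apply]
    exact (phi2_le l hl _).trans ih

/-- the properties of the Stein group that we use -/
structure GoodF (F : Subgroup (Equiv.Perm ℝ)) : Prop where
  mono : ∀ g : F, Monotone g.1
  zero : ∀ g : F, FixL g.1 0
  s_mem : phi2 (3 / 4) (by norm_num) ∈ F
  e_mem : phi2 (1 / 2) (by norm_num) ∈ F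
  a_mem : phi2 (1 / 4) (by norm_num) ∈ F
  b_mem : phi3 (1 / 4) (by norm_num) ∈ F

lemma goodF {F : Subgroup (Equiv.Perm ℝ)}
    (hF : ∀ f : Equiv.Perm ℝ, f ∈ F ↔ IsBS 0 1 zOneSixth twoThreePowers f) : GoodF F where
  mono g := ((hF g.1).1 g.2).1
  zero g := by
    have hm := ((hF g.1).1 g.2).1
    have hneg : ∀ x, x < 0 → g.1 x = x := fun x hx =>
      ((hF g.1).1 g.2).2.1 x fun h => absurd h.1 (not_le.mpr hx)
    have h0 : g.1 0 = 0 := by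
      rcases lt_trichotomy (g.1 0) 0 with h | h | h
      · exact g.1.injective (hneg _ h)
      · exact h
      · have h1 : (g.1⁻¹ : Equiv.Perm ℝ) 0 ≤ 0 := by
          have h2 := mono_inv hm h.le
          rwa [perm_inv_apply] at h2
        rcases h1.lt_or_eq with h2 | h2
        · have h3 := hneg _ h2
          rw [perm_apply_inv] at h3
          exact absurd h3.symm h2.ne
        · rw [Equiv.Perm.inv_eq_iff_eq] at h2
          exact h2.symm
    intro x hx
    rcases hx.lt_or_eq with h | rfl
    · exact hneg x h
    · exact h0
  s_mem := (hF _).2 (phi2_bs _ _ (by norm_num) (mem_sixth 486 (by norm_num))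
    (mem_sixth 729 (by norm_num)) (mem_sixth 972 (by norm_num)))
  e_mem := (hF _).2 (phi2_bs _ _ (by norm_num) (mem_sixth 324 (by norm_num))
    (mem_sixth 486 (by norm_num)) (mem_sixth 648 (by norm_num)))
  a_mem := (hF _).2 (phi2_bs _ _ (by norm_num) (mem_sixth 162 (by norm_num))
    (mem_sixth 243 (by norm_num)) (mem_sixth 324 (by norm_num)))
  b_mem := (hF _).2 (phi3_bs _ _ (by norm_num) (mem_sixth 162 (by norm_num))
    (mem_sixth 270 (by norm_num)) (mem_sixth 324 (by norm_num)))

variable {F : Subgroup (Equiv.Perm ℝ)}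

lemma GoodF.pos (H : GoodF F) (g : F) {x : ℝ} (hx : 0 < x) : 0 < g.1 x := by
  by_contra h
  have h1 := g.1.injective (H.zero g _ (not_lt.mp h))
  exact h (h1.symm ▸ hx)

lemma GoodF.comm (H : GoodF F) {g k : F} {δ : ℝ} (hg : FixL g.1 δ) (hk : FixR k.1 δ) :
    Commute g k :=
  Subtype.ext (comm_of (H.mono g) (H.mono k) hg hk).eq

/-- shrinking elements -/
lemma GoodF.shrink (H : GoodF F) {δ : ℝ} (hδ : 0 < δ) :
    ∃ S : F, S.1 (1 / 2) < δ ∧ ∃ μ, Lin S.1 μ := by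
  obtain ⟨N, hN⟩ := phi2_small (3 / 4) (by norm_num) hδ (by norm_num : (1 / 2 : ℝ) < 3 / 4)
  exact ⟨(⟨_, H.s_mem⟩ : F) ^ N, hN, _, (phi2_lin _ (by norm_num)).pow N⟩

lemma GoodF.cutoff (H : GoodF F) {f : F} (hf : FixR f.1 (1 / 2)) {μ : ℝ} (hl : Lin f.1 μ) {δ : ℝ}
    (hδ : 0 < δ) : ∃ w : F, FixR w.1 δ ∧ ∃ δ' > 0, FixL (f * w).1 δ' := by
  obtain ⟨S, hS, ν, hν⟩ := H.shrink hδ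
  refine ⟨S * f⁻¹ * S⁻¹, ?_, lin_fixL ?_ (H.zero _)⟩
  · have h1 : FixR (S.1 * f.1⁻¹ * S.1⁻¹) (S.1 (1 / 2)) := hf.inv.conj (H.mono S)
    exact h1.mono hS.le
  · have h1 : Lin (f.1 * (S.1 * f.1⁻¹ * S.1⁻¹)) (μ * (ν * μ⁻¹ * ν⁻¹)) :=
      hl.mul ((hν.mul hl.inv).mul hν.inv)
    have h2 : μ * (ν * μ⁻¹ * ν⁻¹) = 1 := by
      have := hl.1.ne'
      have := hν.1.ne'
      field_simp
    rw [h2] at h1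
    exact h1

lemma GoodF.displ (H : GoodF F) {δ ε : ℝ} (hδ : 0 < δ) (hε : ε < 1 / 2) :
    ∃ θ > 0, ∃ g : F, FixL g.1 θ ∧ FixR g.1 (1 / 2) ∧ ∀ n : ℕ, 0 < n → (g ^ n).1 ε ≤ δ := by
  obtain ⟨N, hN⟩ := phi2_small (1 / 2) (by norm_num) hδ hε
  let e : F := ⟨_, H.e_mem⟩
  have he : ∀ x, (e ^ N).1 x ≤ x := phi2_pow_le _ (by norm_num) N
  have heN : (e ^ N).1 ε < δ := hN
  have heR : FixR (e ^ N).1 (1 / 2) := (phi2_fixR _ (by norm_num)).pow N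
  obtain ⟨w, hw, θ, hθ, hwθ⟩ := H.cutoff heR (μ := (1 / 2) ^ N) ((phi2_lin _ (by norm_num)).pow N)
    (lt_min hδ (by norm_num : (0 : ℝ) < 1 / 2))
  have hg1 : ∀ x, δ ≤ x → (e ^ N * w).1 x = (e ^ N).1 x := fun x hx => by
    change (e ^ N).1 (w.1 x) = _
    rw [hw x ((min_le_left _ _).trans hx)]
  have hgδ : (e ^ N * w).1 δ ≤ δ := (hg1 δ le_rfl).trans_le (he δ)
  have hgε : (e ^ N * w).1 ε ≤ δ := by
    rcases le_total δ ε with h | h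
    · exact (hg1 ε h).trans_le heN.le
    · exact (H.mono _ h).trans hgδ
  refine ⟨θ, hθ, e ^ N * w, hwθ, heR.mul (hw.mono (min_le_right _ _)), fun n hn => ?_⟩
  induction n, hn using Nat.le_induction with
  | base => simpa using hgε
  | succ n hn ih =>
    rw [pow_succ']
    exact (H.mono _ ih).trans hgδ

lemma GoodF.displ_comm (H : GoodF F) {u v g : F} {δ ε : ℝ} (hu : FixR u.1 ε) (hv : FixL v.1 δ)
    (hg : g.1 ε ≤ δ) : Commute (g * u * g⁻¹) v :=
  (H.comm hv (FixR.mono (hu.conj (H.mono g)) hg : FixR (g * u * g⁻¹).1 δ)).symm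

/-- commutators of elements supported in `(0, ε)` -/
def MM (F : Subgroup (Equiv.Perm ℝ)) (ε : ℝ) : Set F :=
  {k | ∃ δ > 0, ∃ u v : F, FixL u.1 δ ∧ FixL v.1 δ ∧ FixR u.1 ε ∧ FixR v.1 ε ∧ k = ⁅u, v⁆}

lemma MM_mono {ε ε' : ℝ} (h : ε ≤ ε') : MM F ε ⊆ MM F ε' := by
  rintro k ⟨δ, hδ, u, v, h1, h2, h3, h4, rfl⟩
  exact ⟨δ, hδ, u, v, h1, h2, h3.mono h, h4.mono h, rfl⟩

lemma MM_fixR {ε : ℝ} {k : F} (hk : k ∈ MM F ε) : FixR k.1 ε := by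
  obtain ⟨δ, hδ, u, v, h1, h2, h3, h4, rfl⟩ := hk
  exact h3.comm h4

lemma GoodF.MM_conj (H : GoodF F) {ε : ℝ} {k : F} (hk : k ∈ MM F ε) (g : F) :
    g * k * g⁻¹ ∈ MM F (g.1 ε) := by
  obtain ⟨δ, hδ, u, v, h1, h2, h3, h4, rfl⟩ := hk
  refine ⟨g.1 δ, H.pos g hδ, g * u * g⁻¹, g * v * g⁻¹, h1.conj (H.mono g), h2.conj (H.mono g),
    h3.conj (H.mono g), h4.conj (H.mono g), ?_⟩
  simp only [commutatorElement_def]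
  group

lemma GoodF.MM_ne (H : GoodF F) {ε : ℝ} (hε : 0 < ε) : ∃ k ∈ MM F ε, k ≠ 1 := by
  let a : F := ⟨_, H.a_mem⟩
  have ha : FixR a.1 (1 / 4) := phi2_fixR _ (by norm_num)
  obtain ⟨w, hw, δ, hδ, hwδ⟩ := H.cutoff (f := a) (ha.mono (by norm_num)) (phi2_lin _ (by norm_num))
    (by norm_num : (0 : ℝ) < 1 / 8)
  have hu8 : (a * w).1 (1 / 8) = 1 / 16 := by
    change a.1 (w.1 (1 / 8)) = _
    rw [hw _ le_rfl]
    change phi2 (1 / 4) (by norm_num) (1 / 8) = _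
    rw [phi2_apply]
    norm_num
  have huR : FixR (a * w).1 (1 / 4) := ha.mul (hw.mono (by norm_num))
  have hδ8 : δ ≤ 1 / 8 := by
    by_contra h
    have := hwδ (1 / 8) (not_le.mp h).le
    rw [hu8] at this
    norm_num at this
  obtain ⟨θ, hθ, g, hg1, hg2, hg3⟩ := H.displ hδ (by norm_num : (1 / 4 : ℝ) < 1 / 2)
  have hne : ⁅a * w, g⁆ ≠ 1 := by
    intro h
    rw [commutatorElement_eq_one_iff_commute] at h
    have h1 : g * (a * w) * g⁻¹ = a * w := by rw [← h.eq]; group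
    have h2 : FixR (g * (a * w) * g⁻¹).1 (g.1 (1 / 4)) := huR.conj (H.mono g)
    rw [h1] at h2
    have h3 := h2 (1 / 8) ((by simpa using hg3 1 one_pos : g.1 (1 / 4) ≤ δ).trans hδ8)
    rw [hu8] at h3
    norm_num at h3
  have hM : ⁅a * w, g⁆ ∈ MM F (1 / 2) :=
    ⟨min δ θ, lt_min hδ hθ, _, _, hwδ.mono (min_le_left _ _), hg1.mono (min_le_right _ _),
      huR.mono (by norm_num), hg2, rfl⟩
  obtain ⟨S, hS, -⟩ := H.shrink hε
  refine ⟨_, MM_mono hS.le (H.MM_conj hM S), fun h => hne ?_⟩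
  rwa [conj_eq_one_iff] at h

end asm

section final

variable {F : Subgroup (Equiv.Perm ℝ)} {ι : ↥F →* Equiv.Perm Cantor}

lemma sinf_ne (H : GoodF F) (hι : Function.Injective ι) {k : F} (hk : k ≠ 1) :
    (Sinf (ι k)).Nonempty := by
  by_contra h
  rw [Set.not_nonempty_iff_eq_empty] at h
  obtain ⟨m, hm, h1⟩ := unif_triv (ι := ι) (k := k) isCompact_univ
    (fun x _ hx => by rw [h] at hx; exact hx)
  have h2 : ι (k ^ m) = ι 1 := by
    rw [map_one]
    exact Equiv.ext fun x => (h1 x (Set.mem_univ x)).self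
  have h3 : k ^ m = 1 := hι h2
  exact hk (Subtype.ext (torsion_free (H.mono k) hm (congrArg Subtype.val h3)))

/-- points where some small commutator has infinite order germ -/
def YY (ι : ↥F →* Equiv.Perm Cantor) (ε : ℝ) : Set Cantor :=
  {y | ∃ k ∈ MM F ε, y ∈ Sinf (ι k)}

/-- the limit set -/
def XX (ι : ↥F →* Equiv.Perm Cantor) : Set Cantor := {x | ∀ ε : ℝ, 0 < ε → x ∈ closure (YY ι ε)}

lemma YY_mono {ε ε' : ℝ} (h : ε ≤ ε') : YY ι ε ⊆ YY ι ε' := by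
  rintro y ⟨k, hk, hy⟩
  exact ⟨k, MM_mono h hk, hy⟩

lemma XX_closed : IsClosed (XX ι) := by
  have : XX ι = ⋂ ε : ℝ, ⋂ _ : 0 < ε, closure (YY ι ε) := by
    ext x; simp [XX]
  rw [this]
  exact isClosed_iInter fun ε => isClosed_iInter fun _ => isClosed_closure

lemma XX_nonempty (H : GoodF F) (hι : Function.Injective ι) : (XX ι).Nonempty := by
  have h1 := IsCompact.nonempty_iInter_of_sequence_nonempty_isCompact_isClosed
    (fun n : ℕ => closure (YY ι (1 / ((n : ℝ) + 1))))
    (fun n => closure_mono (YY_mono (by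
      rw [Nat.cast_succ]
      exact one_div_le_one_div_of_le (by positivity) (by linarith))))
    (fun n => by
      obtain ⟨k, hk, hne⟩ := H.MM_ne (ε := 1 / ((n : ℝ) + 1)) (by positivity)
      obtain ⟨y, hy⟩ := sinf_ne H hι hne
      exact ⟨y, subset_closure ⟨k, hk, hy⟩⟩)
    isClosed_closure.isCompact (fun n => isClosed_closure)
  obtain ⟨x, hx⟩ := h1
  refine ⟨x, fun ε hε => ?_⟩
  obtain ⟨n, hn⟩ := exists_nat_one_div_lt hε
  exact closure_mono (YY_mono hn.le) (Set.mem_iInter.mp hx n)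

lemma XX_inv (H : GoodF F) (hV : AllLoc ι) (g : F) (x : Cantor) (hx : x ∈ XX ι) :
    ι g x ∈ XX ι := by
  intro ε hε
  have h1 := hx (g⁻¹.1 ε) (H.pos g⁻¹ hε)
  refine closure_mono ?_ (image_closure_subset_closure_image (cont hV g) ⟨x, h1, rfl⟩)
  rintro _ ⟨y, ⟨k, hk, hy⟩, rfl⟩
  refine ⟨g * k * g⁻¹, ?_, sinf_conj hV hy⟩
  have h2 := H.MM_conj hk g
  have h3 : g.1 (g⁻¹.1 ε) = ε := perm_apply_inv g.1 ε
  rwa [h3] at h2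

lemma comm_NX (H : GoodF F) (hV : AllLoc ι) {u v : F} {δ ε : ℝ} (hδ : 0 < δ) (hε : ε < 1 / 2)
    (hu : FixL u.1 δ) (hv : FixL v.1 δ) (hu' : FixR u.1 ε) :
    ⁅u, v⁆ ∈ NX ι (XX ι) := by
  intro x hx
  obtain ⟨θ, hθ, g, hg, -, hgn⟩ := H.displ hδ hε
  have h1 := hx (min δ θ) (lt_min hδ hθ)
  have h2 : YY ι (min δ θ) ⊆ {x | Triv (ι ⁅u, v⁆) x} := by
    rintro y ⟨k, hk, hy⟩
    have hkR := MM_fixR hk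
    exact disj hV (H.comm hu (hkR.mono (min_le_left _ _))).symm
      (H.comm hv (hkR.mono (min_le_left _ _))).symm (H.comm hg (hkR.mono (min_le_right _ _))).symm
      (fun n hn => H.displ_comm hu' hv (hgn n hn)) hy
  exact closure_minimal h2 (triv_closed (hV _)) h1

lemma comm_lin_NX (H : GoodF F) (hV : AllLoc ι) {a h : F} {μ : ℝ} (ha : FixR a.1 (1 / 4))
    (hl : Lin a.1 μ) (hh : Lin h.1 1) (hh' : FixR h.1 (1 / 4)) : ⁅a, h⁆ ∈ NX ι (XX ι) := by
  obtain ⟨δ, hδ, hhδ⟩ := lin_fixL hh (H.zero h)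
  obtain ⟨w, hw, δ', hδ', hwδ⟩ := H.cutoff (f := a) (ha.mono (by norm_num)) hl
    (lt_min hδ (by norm_num : (0 : ℝ) < 1 / 4))
  have hc : Commute h w := H.comm hhδ (hw.mono (min_le_left _ _))
  have h1 : ⁅a, h⁆ = ⁅a * w, h⁆ := by
    have h2 : w * h * w⁻¹ = h := by rw [← hc.eq]; group
    rw [commutatorElement_def, commutatorElement_def, mul_inv_rev]
    calc a * h * a⁻¹ * h⁻¹ = a * (w * h * w⁻¹) * a⁻¹ * h⁻¹ := by rw [h2]
      _ = _ := by group
  rw [h1]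
  exact comm_NX H hV (δ := min δ' δ) (ε := 1 / 4) (lt_min hδ' hδ) (by norm_num)
    (hwδ.mono (min_le_left _ _)) (hhδ.mono (min_le_right _ _))
    (ha.mul (hw.mono (min_le_right _ _)))

lemma no_contr (H : GoodF F) (hV : AllLoc ι) {c : F} {μ : ℝ} (hc : Lin c.1 μ) (hμ : μ < 1)
    {x : Cantor} (hx : x ∈ XX ι) (hT : Triv (ι c) x) : False := by
  obtain ⟨hμ0, ρ, hρ, hρc⟩ := hc
  have hε : 0 < min ρ (1 / 3) := lt_min hρ (by norm_num)
  obtain ⟨y, hyU, k, ⟨δ, hδ, u, v, h1, h2, h3, h4, rfl⟩, hy⟩ :=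
    mem_closure_iff.mp (hx _ hε) _ (isOpen_triv (ι c)) hT
  obtain ⟨θ, hθ, g, hg, -, hgn⟩ := H.displ hδ
    (lt_of_le_of_lt (min_le_right ρ (1 / 3)) (by norm_num : (1 / 3 : ℝ) < 1 / 2))
  have hcn : ∀ n : ℕ, (c ^ n).1 (min ρ (1 / 3)) = μ ^ n * min ρ (1 / 3) := by
    intro n
    induction n with
    | zero => simp
    | succ n ih =>
      rw [pow_succ' c]
      change c.1 ((c ^ n).1 _) = _
      have h5 : μ ^ n ≤ 1 := pow_le_one₀ hμ0.le hμ.le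
      rw [ih, hρc _ (by positivity), pow_succ']
      · ring
      · calc μ ^ n * min ρ (1 / 3) ≤ 1 * min ρ (1 / 3) := by gcongr
          _ ≤ ρ := by rw [one_mul]; exact min_le_left _ _
  obtain ⟨n, hn⟩ : ∃ n : ℕ, μ ^ n * min ρ (1 / 3) ≤ min δ θ := by
    obtain ⟨n, hn⟩ := exists_pow_lt_of_lt_one (div_pos (lt_min hδ hθ) hε) hμ
    exact ⟨n, (lt_div_iff₀ hε).mp hn |>.le⟩
  have hk' : FixR (c ^ n * ⁅u, v⁆ * (c ^ n)⁻¹).1 (min δ θ) := by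
    have h5 : FixR (c ^ n * ⁅u, v⁆ * (c ^ n)⁻¹).1 ((c ^ n).1 (min ρ (1 / 3))) :=
      FixR.conj (h3.comm h4) (H.mono (c ^ n))
    rw [hcn] at h5
    exact h5.mono hn
  have hyf : ι (c ^ n) y = y := by
    rw [map_pow]
    exact iter_fix (Triv.self hyU) n
  have hy' : y ∈ Sinf (ι (c ^ n * ⁅u, v⁆ * (c ^ n)⁻¹)) := by
    have h5 := sinf_conj hV (g := c ^ n) hy
    rwa [hyf] at h5
  have hTr : Triv (ι ⁅u, v⁆) y :=
    disj hV (H.comm h1 (hk'.mono (min_le_left _ _))).symm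
      (H.comm h2 (hk'.mono (min_le_left _ _))).symm (H.comm hg (hk'.mono (min_le_right _ _))).symm
      (fun n hn => H.displ_comm h3 h2 (hgn n hn)) hy'
  exact hy 1 one_ne_zero (by rwa [zpow_one])

lemma main (H : GoodF F) (hV : AllLoc ι) (hι : Function.Injective ι) : False := by
  let a : F := ⟨_, H.a_mem⟩
  let b : F := ⟨_, H.b_mem⟩
  have ha : FixR a.1 (1 / 4) := phi2_fixR _ (by norm_num)
  have hb : FixR b.1 (1 / 4) := phi3_fixR _ (by norm_num)
  have la : Lin a.1 (1 / 2) := phi2_lin _ (by norm_num)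
  have lb : Lin b.1 (1 / 3) := phi3_lin _ (by norm_num)
  have hR : FixR (⁅a, b⁆ : F).1 (1 / 4) := ha.comm hb
  have hL : Lin (⁅a, b⁆ : F).1 1 := by
    have h1 : Lin (a.1 * b.1 * a.1⁻¹ * b.1⁻¹) (1 / 2 * (1 / 3) * (1 / 2)⁻¹ * (1 / 3)⁻¹) :=
      ((la.mul lb).mul la.inv).mul lb.inv
    norm_num at h1
    exact h1
  obtain ⟨x, hx, i, j, hij, hT⟩ := exists_dep hV XX_closed (XX_nonempty H hι) (XX_inv H hV)
    (comm_lin_NX H hV ha la hL hR) (comm_lin_NX H hV hb lb hL hR)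
  have hc : Lin (a ^ i * b ^ j).1 ((1 / 2) ^ i * (1 / 3) ^ j) := (la.zpow i).mul (lb.zpow j)
  rcases lt_or_gt_of_ne (slope_ne hij) with h | h
  · exact no_contr H hV hc h hx hT
  · have hc' : Lin ((a ^ i * b ^ j)⁻¹ : F).1 ((1 / 2) ^ i * (1 / 3) ^ j)⁻¹ := hc.inv
    refine no_contr H hV hc' (inv_lt_one_of_one_lt₀ h) hx ?_
    rw [map_inv]
    exact hT.inv

end final

end SteinV

/-- **Corollary D.** The Stein group `F_{2,3}` does not embed in Thompson's group `V`. -/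
theorem stein_group_no_embedding_in_V (F : Subgroup (Equiv.Perm ℝ))
    (hF : ∀ f : Equiv.Perm ℝ, f ∈ F ↔ IsBS 0 1 zOneSixth twoThreePowers f) :
    ¬ ∃ ι : ↥F →* Equiv.Perm Cantor, Function.Injective ι ∧ ∀ f : ↥F, InV (ι f) := by
  rintro ⟨ι, hι, hV⟩
  exact SteinV.main (SteinV.goodF hF) (fun g x => SteinV.loc_of_inV (hV g) x) hι
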